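/- arXiv:1306.3142 — 4 statements merged into one kernel-verified Lean document; each statement's English description precedes it below -/
import Mathlib

section
/- Let ρ, σ be positive semidefinite complex n×n matrices with ρ ≠ 0. Then the map α ↦ D̃_α(ρ‖σ) is monotonically increasing on (0, 1) ∪ (1, ∞): for all α, β ∈ (0,1) ∪ (1,∞) with α ≤ β, one has D̃_α(ρ‖σ) ≤ D̃_β(ρ‖σ) in ℝ ∪ {+∞}. -/
open Matrix
open scoped Kronecker Classical ComplexOrder

/-- Real power of a matrix via functional calculus on the eigenvalues of a Hermitian
matrix, with the convention that eigenvalue `0` is mapped to `0` (powers are taken on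
the support). Non-Hermitian matrices are mapped to `0`. -/
noncomputable def matPow {n : Type*} [Fintype n] [DecidableEq n]
    (A : Matrix n n ℂ) (t : ℝ) : Matrix n n ℂ :=
  if hA : A.IsHermitian then
    (hA.eigenvectorUnitary : Matrix n n ℂ) *
      Matrix.diagonal (fun i =>
        ((if hA.eigenvalues i = 0 then (0 : ℝ) else hA.eigenvalues i ^ t : ℝ) : ℂ)) *
      (star (hA.eigenvectorUnitary : Matrix n n ℂ))
  else 0

/-- `dominates σ ρ` (written `σ ≫ ρ` in the paper): the kernel of `σ` is contained in
the kernel of `ρ`. -/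
def dominates {n : Type*} [Fintype n] (σ ρ : Matrix n n ℂ) : Prop :=
  ∀ v : n → ℂ, σ.mulVec v = 0 → ρ.mulVec v = 0

/-- The sandwiched Rényi divergence of order `α`, with values in `ℝ ∪ {+∞}` (as a
subset of `EReal`), logarithms base 2. It is `+∞` unless `ρ` is not orthogonal to `σ`
(i.e. `Tr[ρσ] ≠ 0`) and (`σ ≫ ρ` or `α < 1`). -/
noncomputable def Dtilde {n : Type*} [Fintype n] [DecidableEq n]
    (α : ℝ) (ρ σ : Matrix n n ℂ) : EReal :=
  if (ρ * σ).trace ≠ 0 ∧ (dominates σ ρ ∨ α < 1) then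
    (((α - 1)⁻¹ * Real.logb 2
        ((matPow (matPow σ ((1 - α) / (2 * α)) * ρ * matPow σ ((1 - α) / (2 * α))) α).trace.re
          / ρ.trace.re) : ℝ) : EReal)
  else ⊤

theorem weighted_rpow_mean_le_rpow_mean {ι : Type*} [Fintype ι] {w z : ι → ℝ} {r s : ℝ}
    (hw : ∀ i, 0 ≤ w i) (hw1 : ∑ i, w i = 1) (hz : ∀ i, 0 ≤ z i) (hr : r ≠ 0) (hs : s ≠ 0)
    (hrs : r ≤ s) (hpos : 0 < r ∨ ∀ i, w i ≠ 0 → 0 < z i) :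
    (∑ i, w i * z i ^ r) ^ (1 / r) ≤ (∑ i, w i * z i ^ s) ^ (1 / s) := by
  have base : ∀ {y : ι → ℝ} {a b : ℝ}, (∀ i, 0 ≤ y i) → 0 < a → a ≤ b →
      (∑ i, w i * y i ^ a) ^ (1 / a) ≤ (∑ i, w i * y i ^ b) ^ (1 / b) := by
    intro y a b hy ha hab
    have hb := ha.trans_le hab
    have hS : 0 ≤ ∑ i, w i * y i ^ a :=
      Finset.sum_nonneg fun i _ => mul_nonneg (hw i) (Real.rpow_nonneg (hy i) _)
    have h := Real.rpow_arith_mean_le_arith_mean_rpow Finset.univ w (fun i => y i ^ a)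
      (fun i _ => hw i) hw1 (fun i _ => Real.rpow_nonneg (hy i) _) ((one_le_div ha).2 hab)
    have h2 := Real.rpow_le_rpow (Real.rpow_nonneg hS _) h (one_div_pos.2 hb).le
    rw [← Real.rpow_mul hS] at h2
    simp only [← Real.rpow_mul (hy _)] at h2
    rwa [show b / a * (1 / b) = 1 / a by field_simp, show a * (b / a) = b by field_simp] at h2
  rcases hpos with hr0 | hpos
  · exact base hz hr0 hrs
  rcases lt_or_gt_of_ne hr with hr0 | hr0
  swap
  · exact base hz hr0 hrs
  set y : ι → ℝ := fun i => if w i = 0 then 1 else z i with hydef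
  have hy : ∀ i, 0 < y i := by
    intro i
    by_cases h : w i = 0
    · simp [hydef, h]
    · simpa [hydef, h] using hpos i h
  have hyz : ∀ t : ℝ, ∑ i, w i * z i ^ t = ∑ i, w i * y i ^ t := by
    intro t
    refine Finset.sum_congr rfl fun i _ => ?_
    by_cases h : w i = 0 <;> simp [hydef, h]
  rw [hyz, hyz]
  have hSpos : ∀ t : ℝ, 0 < ∑ i, w i * y i ^ t := by
    intro t
    have hn : ∀ i ∈ Finset.univ, 0 ≤ w i * y i ^ t :=
      fun i _ => mul_nonneg (hw i) (Real.rpow_nonneg (hy i).le _)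
    refine (Finset.sum_nonneg hn).lt_of_ne' fun h0 => ?_
    rw [Finset.sum_eq_zero_iff_of_nonneg hn] at h0
    have : ∑ i, w i = 0 := Finset.sum_eq_zero fun i hi =>
      (mul_eq_zero.1 (h0 i hi)).resolve_right (Real.rpow_pos_of_pos (hy i) _).ne'
    linarith
  have hinv : ∀ i, 0 ≤ (y i)⁻¹ := fun i => (inv_pos.2 (hy i)).le
  have hflip : ∀ t : ℝ, (∑ i, w i * (y i)⁻¹ ^ (-t)) ^ (1 / -t) =
      ((∑ i, w i * y i ^ t) ^ (1 / t))⁻¹ := by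
    intro t
    have : ∀ i, (y i)⁻¹ ^ (-t) = y i ^ t := fun i => by
      rw [Real.inv_rpow (hy i).le, Real.rpow_neg (hy i).le, inv_inv]
    simp only [this]
    rw [one_div_neg_eq_neg_one_div, Real.rpow_neg (hSpos t).le]
  have geom : ∀ {x : ι → ℝ} {a : ℝ}, (∀ i, 0 ≤ x i) → 0 < a →
      ∏ i, x i ^ w i ≤ (∑ i, w i * x i ^ a) ^ (1 / a) := by
    intro x a hx ha
    have h := Real.geom_mean_le_arith_mean_weighted Finset.univ w (fun i => x i ^ a)
      (fun i _ => hw i) hw1 (fun i _ => Real.rpow_nonneg (hx i) _)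
    have hP : 0 ≤ ∏ i, x i ^ w i := Finset.prod_nonneg fun i _ => Real.rpow_nonneg (hx i) _
    have e : ∏ i, (x i ^ a) ^ w i = (∏ i, x i ^ w i) ^ a := by
      rw [← Real.finsetProd_rpow _ _ fun i _ => Real.rpow_nonneg (hx i) _]
      refine Finset.prod_congr rfl fun i _ => ?_
      rw [← Real.rpow_mul (hx i), ← Real.rpow_mul (hx i), mul_comm]
    rw [e] at h
    have h2 := Real.rpow_le_rpow (Real.rpow_nonneg hP _) h (one_div_pos.2 ha).le
    rwa [← Real.rpow_mul hP, mul_one_div_cancel ha.ne', Real.rpow_one] at h2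
  rcases lt_or_gt_of_ne hs with hs0 | hs0
  · have h := base hinv (neg_pos.2 hs0) (neg_le_neg hrs)
    rw [hflip, hflip] at h
    exact (inv_le_inv₀ (Real.rpow_pos_of_pos (hSpos s) _)
      (Real.rpow_pos_of_pos (hSpos r) _)).1 h
  · have h := geom hinv (neg_pos.2 hr0)
    rw [hflip] at h
    simp only [Real.inv_rpow (hy _).le, Finset.prod_inv_distrib] at h
    exact ((inv_le_inv₀ (Finset.prod_pos fun i _ => Real.rpow_pos_of_pos (hy i) _)
      (Real.rpow_pos_of_pos (hSpos r) _)).1 h).trans (geom (fun i => (hy i).le) hs0)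

theorem weighted_rpow_mean_mono {ι : Type*} [Fintype ι] {w y z : ι → ℝ} {r : ℝ}
    (hw : ∀ i, 0 ≤ w i) (hy : ∀ i, 0 ≤ y i) (hr : r ≠ 0) (hyz : ∀ i, w i ≠ 0 → y i ≤ z i)
    (hpos : 0 < r ∨ ((∃ i, w i ≠ 0) ∧ ∀ i, w i ≠ 0 → 0 < y i)) :
    (∑ i, w i * y i ^ r) ^ (1 / r) ≤ (∑ i, w i * z i ^ r) ^ (1 / r) := by
  rcases lt_or_gt_of_ne hr with hr0 | hr0
  · obtain ⟨⟨k, hk⟩, hpos⟩ := hpos.resolve_left hr0.not_gt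
    have hterm : ∀ i, 0 ≤ w i * z i ^ r := fun i => by
      by_cases h : w i = 0
      · simp [h]
      · exact mul_nonneg (hw i) (Real.rpow_nonneg ((hy i).trans (hyz i h)) _)
    refine Real.rpow_le_rpow_of_nonpos ?_ ?_ (one_div_neg.2 hr0).le
    · exact Finset.sum_pos' (fun i _ => hterm i) ⟨k, Finset.mem_univ _,
        mul_pos ((hw k).lt_of_ne' hk)
          (Real.rpow_pos_of_pos ((hpos k hk).trans_le (hyz k hk)) _)⟩
    · refine Finset.sum_le_sum fun i _ => ?_
      by_cases h : w i = 0
      · simp [h]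
      · exact mul_le_mul_of_nonneg_left
          (Real.rpow_le_rpow_of_nonpos (hpos i h) (hyz i h) hr0.le) (hw i)
  · refine Real.rpow_le_rpow ?_ ?_ (one_div_pos.2 hr0).le
    · exact Finset.sum_nonneg fun i _ => mul_nonneg (hw i) (Real.rpow_nonneg (hy i) _)
    · refine Finset.sum_le_sum fun i _ => ?_
      by_cases h : w i = 0
      · simp [h]
      · exact mul_le_mul_of_nonneg_left (Real.rpow_le_rpow (hy i) (hyz i h) hr0.le) (hw i)

/-- Classical counterpart of the monotonicity in `α`: for nonnegative weights `p i j` and levels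
`l j`, the functional is minus the logarithm of a nested power mean. -/
theorem renyi_weights_mono {ι κ : Type*} [Fintype ι] [Fintype κ] {p : ι → κ → ℝ} {l : κ → ℝ}
    (hp : ∀ i j, 0 ≤ p i j) (hl : ∀ j, 0 ≤ l j) (hne : ∃ i j, 0 < p i j * l j)
    {α β : ℝ} (hα : 0 < α) (hα1 : α ≠ 1) (hβ1 : β ≠ 1) (hαβ : α ≤ β)
    (hpos : β < 1 ∨ ∀ i j, p i j ≠ 0 → 0 < l j) :
    (α - 1)⁻¹ * Real.logb 2 ((∑ i, (∑ j, p i j * l j ^ ((1 - α) / α)) ^ α) / ∑ i, ∑ j, p i j) ≤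
    (β - 1)⁻¹ *
      Real.logb 2 ((∑ i, (∑ j, p i j * l j ^ ((1 - β) / β)) ^ β) / ∑ i, ∑ j, p i j) := by
  have hβ := hα.trans_le hαβ
  set q : ι → ℝ := fun i => ∑ j, p i j with hq
  have hq0 : ∀ i, 0 ≤ q i := fun i => Finset.sum_nonneg fun j _ => hp i j
  obtain ⟨a, b, hab⟩ := hne
  have hpab : 0 < p a b := (hp a b).lt_of_ne' fun h => by simp [h] at hab
  have hlb : 0 < l b := (hl b).lt_of_ne' fun h => by simp [h] at hab
  have hqa : 0 < q a := Finset.sum_pos' (fun j _ => hp a j) ⟨b, Finset.mem_univ _, hpab⟩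
  have hS : 0 < ∑ i, q i := Finset.sum_pos' (fun i _ => hq0 i) ⟨a, Finset.mem_univ _, hqa⟩
  set S := ∑ i, q i
  set Y : ℝ → ι → ℝ := fun γ i => ∑ j, p i j / q i * l j ^ ((1 - γ) / γ) with hY
  have hY0 : ∀ γ i, 0 ≤ Y γ i := fun γ i => Finset.sum_nonneg fun j _ =>
    mul_nonneg (div_nonneg (hp i j) (hq0 i)) (Real.rpow_nonneg (hl j) _)
  set z : ℝ → ι → ℝ := fun γ i => Y γ i ^ (1 / ((1 - γ) / γ)) / q i with hz
  have hz0 : ∀ γ i, 0 ≤ z γ i := fun γ i => div_nonneg (Real.rpow_nonneg (hY0 γ i) _) (hq0 i)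
  set T : ℝ → ℝ := fun γ => ∑ i, q i / S * z γ i ^ (1 - γ) with hT
  have hrepr : ∀ γ : ℝ, 0 < γ → γ ≠ 1 →
      (γ - 1)⁻¹ * Real.logb 2 ((∑ i, (∑ j, p i j * l j ^ ((1 - γ) / γ)) ^ γ) / S) =
        -Real.logb 2 (T γ ^ (1 / (1 - γ))) := by
    intro γ hγ hγ1
    have h1 : 1 - γ ≠ 0 := sub_ne_zero.2 hγ1.symm
    have hTγ : (∑ i, (∑ j, p i j * l j ^ ((1 - γ) / γ)) ^ γ) / S = T γ := by
      rw [hT, Finset.sum_div]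
      refine Finset.sum_congr rfl fun i _ => ?_
      rcases (hq0 i).eq_or_lt with h | h
      · have : ∀ j, p i j = 0 := fun j =>
          (Finset.sum_eq_zero_iff_of_nonneg fun j _ => hp i j).1 h.symm j (Finset.mem_univ _)
        simp [this, ← h, Real.zero_rpow hγ.ne']
      · have e : ∑ j, p i j * l j ^ ((1 - γ) / γ) = q i * Y γ i := by
          rw [hY, Finset.mul_sum]
          refine Finset.sum_congr rfl fun j _ => ?_
          field_simp
        rw [e, Real.mul_rpow h.le (hY0 γ i), hz]
        simp only
        rw [Real.div_rpow (Real.rpow_nonneg (hY0 γ i) _) h.le, ← Real.rpow_mul (hY0 γ i),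
          show 1 / ((1 - γ) / γ) * (1 - γ) = γ by field_simp, Real.rpow_sub h, Real.rpow_one]
        field_simp
    have hT0 : 0 ≤ T γ := Finset.sum_nonneg fun i _ =>
      mul_nonneg (div_nonneg (hq0 i) hS.le) (Real.rpow_nonneg (hz0 γ i) _)
    rw [hTγ, ← neg_sub 1 γ, inv_neg, neg_mul, ← one_div]
    rcases hT0.eq_or_lt with h | h
    · rw [← h, Real.zero_rpow (one_div_ne_zero h1)]
      simp
    · rw [Real.logb_rpow_eq_mul_logb_of_pos h]
  have hYa : 0 < Y β a := Finset.sum_pos'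
    (fun j _ => mul_nonneg (div_nonneg (hp a j) (hq0 a)) (Real.rpow_nonneg (hl j) _))
    ⟨b, Finset.mem_univ _, mul_pos (div_pos hpab hqa) (Real.rpow_pos_of_pos hlb _)⟩
  have hTβ : 0 < T β := Finset.sum_pos'
    (fun i _ => mul_nonneg (div_nonneg (hq0 i) hS.le) (Real.rpow_nonneg (hz0 β i) _))
    ⟨a, Finset.mem_univ _, mul_pos (div_pos hqa hS)
      (Real.rpow_pos_of_pos (div_pos (Real.rpow_pos_of_pos hYa _) hqa) _)⟩
  have hα' : 1 - α ≠ 0 := sub_ne_zero.2 hα1.symm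
  have hβ' : 1 - β ≠ 0 := sub_ne_zero.2 hβ1.symm
  have hqi : ∀ i, q i / S ≠ 0 → 0 < q i := fun i hi =>
    (hq0 i).lt_of_ne' fun h => by simp [h] at hi
  have hzpos : β < 1 ∨ ∀ i, q i / S ≠ 0 → 0 < z β i := by
    refine hpos.imp_right fun h i hi => ?_
    have hi' := hqi i hi
    refine div_pos (Real.rpow_pos_of_pos ?_ _) hi'
    obtain ⟨j, -, hj⟩ := Finset.exists_ne_zero_of_sum_ne_zero hi'.ne'
    exact Finset.sum_pos'
      (fun j _ => mul_nonneg (div_nonneg (hp i j) (hq0 i)) (Real.rpow_nonneg (hl j) _))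
      ⟨j, Finset.mem_univ _, mul_pos (div_pos ((hp i j).lt_of_ne' hj) hi')
        (Real.rpow_pos_of_pos (h i j hj) _)⟩
  have hzmono : ∀ i, q i / S ≠ 0 → z β i ≤ z α i := by
    intro i hi
    have hi' := hqi i hi
    refine div_le_div_of_nonneg_right ?_ hi'.le
    refine weighted_rpow_mean_le_rpow_mean (fun j => div_nonneg (hp i j) hi'.le) ?_ hl
      (div_ne_zero hβ' hβ.ne') (div_ne_zero hα' hα.ne') ?_ ?_
    · rw [← Finset.sum_div]
      exact div_self hi'.ne'
    · rw [div_le_div_iff₀ hβ hα]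
      nlinarith
    · exact hpos.imp (fun h => div_pos (by linarith) hβ)
        fun h j hj => h i j fun h0 => hj (by simp [h0])
  rw [hrepr α hα hα1, hrepr β hβ hβ1, neg_le_neg_iff]
  refine Real.logb_le_logb_of_le one_lt_two (Real.rpow_pos_of_pos hTβ _) ?_
  refine (weighted_rpow_mean_le_rpow_mean (fun i => div_nonneg (hq0 i) hS.le) ?_ (hz0 β)
    hβ' hα' (by linarith) ?_).trans
    (weighted_rpow_mean_mono (fun i => div_nonneg (hq0 i) hS.le) (hz0 β) hα' hzmono ?_)
  · rw [← Finset.sum_div]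
    exact div_self hS.ne'
  · exact hzpos.imp_left fun h => by linarith
  · exact hzpos.imp (fun h => by linarith) fun h => ⟨⟨a, (div_pos hqa hS).ne'⟩, h⟩

section MatrixLemmas

variable {n : Type*} [Fintype n] [DecidableEq n]

theorem conjTranspose_mul_diagonal_mul_apply_self (N : Matrix n n ℂ) (d : n → ℝ) (i : n) :
    (Nᴴ * diagonal (fun j => (d j : ℂ)) * N) i i =
      ((∑ j, Complex.normSq (N j i) * d j : ℝ) : ℂ) := by
  rw [Matrix.mul_apply]
  push_cast
  refine Finset.sum_congr rfl fun j _ => ?_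
  rw [Matrix.mul_diagonal, Matrix.conjTranspose_apply, Complex.normSq_eq_conj_mul_self,
    starRingEnd_apply]
  ring

theorem sum_normSq_col_eq_one {V : Matrix n n ℂ} (hV : Vᴴ * V = 1) (i : n) :
    ∑ j, Complex.normSq (V j i) = 1 := by
  have h := conjTranspose_mul_diagonal_mul_apply_self V (fun _ => 1) i
  simp only [Complex.ofReal_one, Matrix.diagonal_one, hV, Matrix.one_apply_eq, mul_one] at h
  exact_mod_cast h.symm

theorem sum_normSq_row_eq_one {V : Matrix n n ℂ} (hV : V * Vᴴ = 1) (j : n) :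
    ∑ i, Complex.normSq (V j i) = 1 := by
  have h := sum_normSq_col_eq_one (V := Vᴴ) (by rwa [conjTranspose_conjTranspose]) j
  simpa [Matrix.conjTranspose_apply] using h

theorem Matrix.IsHermitian.eq_eigenvectorUnitary_conj {A : Matrix n n ℂ} (hA : A.IsHermitian) :
    A = (hA.eigenvectorUnitary : Matrix n n ℂ) * diagonal (fun i => (hA.eigenvalues i : ℂ)) *
      (hA.eigenvectorUnitary : Matrix n n ℂ)ᴴ := by
  conv_lhs => rw [hA.spectral_theorem, Unitary.conjStarAlgAut_apply]
  rfl

theorem Matrix.IsHermitian.eigenvectorUnitary_conjTranspose_mul_self {A : Matrix n n ℂ}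
    (hA : A.IsHermitian) :
    (hA.eigenvectorUnitary : Matrix n n ℂ)ᴴ * (hA.eigenvectorUnitary : Matrix n n ℂ) = 1 :=
  Unitary.coe_star_mul_self hA.eigenvectorUnitary

theorem Matrix.IsHermitian.eigenvectorUnitary_mul_conjTranspose_self {A : Matrix n n ℂ}
    (hA : A.IsHermitian) :
    (hA.eigenvectorUnitary : Matrix n n ℂ) * (hA.eigenvectorUnitary : Matrix n n ℂ)ᴴ = 1 :=
  Unitary.coe_mul_star_self hA.eigenvectorUnitary

theorem Matrix.IsHermitian.eigenvectorUnitary_conj_eq_diagonal {A : Matrix n n ℂ}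
    (hA : A.IsHermitian) :
    (hA.eigenvectorUnitary : Matrix n n ℂ)ᴴ * A * (hA.eigenvectorUnitary : Matrix n n ℂ) =
      diagonal (fun i => (hA.eigenvalues i : ℂ)) := by
  have h := congrArg (fun M => (hA.eigenvectorUnitary : Matrix n n ℂ)ᴴ * M *
    (hA.eigenvectorUnitary : Matrix n n ℂ)) hA.eq_eigenvectorUnitary_conj
  simp only [Matrix.mul_assoc, hA.eigenvectorUnitary_conjTranspose_mul_self, Matrix.mul_one] at h
  rw [Matrix.mul_assoc, h, ← Matrix.mul_assoc, hA.eigenvectorUnitary_conjTranspose_mul_self,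
    Matrix.one_mul]

/-- Peierls' inequality for the diagonal of a positive semidefinite matrix in an orthonormal
basis. -/
theorem sum_convexOn_diag_le_sum_eigenvalues {X W : Matrix n n ℂ} (hX : X.PosSemidef)
    (hW : Wᴴ * W = 1) {f : ℝ → ℝ} (hf : ConvexOn ℝ (Set.Ici 0) f) :
    ∑ i, f ((Wᴴ * X * W) i i).re ≤ ∑ i, f (hX.isHermitian.eigenvalues i) := by
  have hH := hX.isHermitian
  set U : Matrix n n ℂ := ↑hH.eigenvectorUnitary with hU
  have hU1 : U * Uᴴ = 1 := hH.eigenvectorUnitary_mul_conjTranspose_self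
  have hU2 : Uᴴ * U = 1 := hH.eigenvectorUnitary_conjTranspose_mul_self
  have hW' : W * Wᴴ = 1 := mul_eq_one_comm.1 hW
  set V := Uᴴ * W with hV
  have hV1 : Vᴴ * V = 1 := by
    rw [hV, conjTranspose_mul, conjTranspose_conjTranspose, Matrix.mul_assoc,
      ← Matrix.mul_assoc U, hU1, Matrix.one_mul, hW]
  have hV2 : V * Vᴴ = 1 := mul_eq_one_comm.1 hV1
  have hdiag : ∀ i, ((Wᴴ * X * W) i i).re =
      ∑ k, Complex.normSq (V k i) * hH.eigenvalues k := by
    intro i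
    have e : Wᴴ * X * W = Vᴴ * diagonal (fun k => (hH.eigenvalues k : ℂ)) * V := by
      conv_lhs => rw [hH.eq_eigenvectorUnitary_conj]
      simp only [hV, ← hU, conjTranspose_mul, conjTranspose_conjTranspose, Matrix.mul_assoc]
    rw [e, conjTranspose_mul_diagonal_mul_apply_self, Complex.ofReal_re]
  calc ∑ i, f ((Wᴴ * X * W) i i).re
      ≤ ∑ i, ∑ k, Complex.normSq (V k i) * f (hH.eigenvalues k) := by
        refine Finset.sum_le_sum fun i _ => ?_
        rw [hdiag]
        exact hf.map_sum_le (fun k _ => Complex.normSq_nonneg _) (sum_normSq_col_eq_one hV1 i)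
          fun k _ => hX.eigenvalues_nonneg k
    _ = ∑ k, f (hH.eigenvalues k) := by
        rw [Finset.sum_comm]
        refine Finset.sum_congr rfl fun k _ => ?_
        rw [← Finset.sum_mul, sum_normSq_row_eq_one hV2, one_mul]

theorem sum_eigenvalues_congr {A B : Matrix n n ℂ} (hA : A.IsHermitian) (hB : B.IsHermitian)
    (h : A.charpoly = B.charpoly) (f : ℝ → ℝ) :
    ∑ i, f (hA.eigenvalues i) = ∑ i, f (hB.eigenvalues i) := by
  have h1 := hA.roots_charpoly_eq_eigenvalues
  rw [h, hB.roots_charpoly_eq_eigenvalues] at h1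
  have h2 := congrArg (fun s => (s.map fun z : ℂ => f z.re).sum) h1
  simp only [Multiset.map_map] at h2
  exact h2.symm

theorem matPow_eq {A : Matrix n n ℂ} (hA : A.IsHermitian) (t : ℝ) :
    matPow A t = (hA.eigenvectorUnitary : Matrix n n ℂ) *
      diagonal (fun i =>
        ((if hA.eigenvalues i = 0 then (0 : ℝ) else hA.eigenvalues i ^ t : ℝ) : ℂ)) *
      (hA.eigenvectorUnitary : Matrix n n ℂ)ᴴ := by
  rw [matPow, dif_pos hA]
  rfl

theorem matPow_isHermitian {A : Matrix n n ℂ} (hA : A.IsHermitian) (t : ℝ) :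
    (matPow A t).IsHermitian := by
  rw [matPow_eq hA]
  refine isHermitian_mul_mul_conjTranspose _ (isHermitian_diagonal_of_self_adjoint _ ?_)
  ext i
  simp

theorem matPow_mul_matPow {A : Matrix n n ℂ} (hA : A.PosSemidef) (s t : ℝ) :
    matPow A s * matPow A t = matPow A (s + t) := by
  have hU2 := hA.isHermitian.eigenvectorUnitary_conjTranspose_mul_self
  rw [matPow_eq hA.isHermitian, matPow_eq hA.isHermitian, matPow_eq hA.isHermitian]
  set U : Matrix n n ℂ := ↑hA.isHermitian.eigenvectorUnitary
  simp only [Matrix.mul_assoc]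
  rw [← Matrix.mul_assoc Uᴴ, hU2, Matrix.one_mul, ← Matrix.mul_assoc (diagonal _) (diagonal _),
    diagonal_mul_diagonal]
  congr 3
  ext i
  by_cases h : hA.isHermitian.eigenvalues i = 0
  · simp [h]
  · simp only [h, if_false]
    rw [Real.rpow_add ((hA.eigenvalues_nonneg i).lt_of_ne' h), Complex.ofReal_mul]

theorem trace_matPow {A : Matrix n n ℂ} (hA : A.IsHermitian) {t : ℝ} (ht : t ≠ 0) :
    (matPow A t).trace.re = ∑ i, hA.eigenvalues i ^ t := by
  rw [matPow_eq hA, Matrix.mul_assoc, Matrix.trace_mul_comm, Matrix.mul_assoc,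
    hA.eigenvectorUnitary_conjTranspose_mul_self, Matrix.mul_one, Matrix.trace_diagonal,
    ← Complex.ofReal_sum, Complex.ofReal_re]
  refine Finset.sum_congr rfl fun i _ => ?_
  split_ifs with h
  · rw [h, Real.zero_rpow ht]
  · rfl

theorem posSemidef_mul_matPow_mul_conjTranspose {σ : Matrix n n ℂ} (hσ : σ.PosSemidef)
    (B : Matrix n n ℂ) (t : ℝ) : (B * matPow σ t * Bᴴ).PosSemidef := by
  have h : B * matPow σ t * Bᴴ = (B * matPow σ (t / 2)) * (B * matPow σ (t / 2))ᴴ := by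
    rw [conjTranspose_mul, (matPow_isHermitian hσ.isHermitian _).eq]
    nth_rewrite 1 [← add_halves t]
    rw [← matPow_mul_matPow hσ]
    simp only [Matrix.mul_assoc]
  rw [h]
  exact posSemidef_self_mul_conjTranspose _

theorem trace_matPow_sandwich {σ : Matrix n n ℂ} (hσ : σ.PosSemidef) (B : Matrix n n ℂ)
    {t α : ℝ} (hα : α ≠ 0) :
    (matPow (matPow σ (t / 2) * (Bᴴ * B) * matPow σ (t / 2)) α).trace.re =
      ∑ i, (posSemidef_mul_matPow_mul_conjTranspose hσ B t).isHermitian.eigenvalues i ^ α := by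
  have hS := matPow_isHermitian hσ.isHermitian (t / 2)
  have hA : (matPow σ (t / 2) * (Bᴴ * B) * matPow σ (t / 2)).IsHermitian := by
    have h := isHermitian_mul_mul_conjTranspose (matPow σ (t / 2))
      (isHermitian_conjTranspose_mul_self B)
    rwa [hS.eq] at h
  rw [trace_matPow hA hα]
  refine sum_eigenvalues_congr hA _ ?_ (fun x => x ^ α)
  have e1 : matPow σ (t / 2) * (Bᴴ * B) * matPow σ (t / 2) =
      (matPow σ (t / 2) * Bᴴ) * (B * matPow σ (t / 2)) := by simp only [Matrix.mul_assoc]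
  have e2 : B * matPow σ t * Bᴴ = (B * matPow σ (t / 2)) * (matPow σ (t / 2) * Bᴴ) := by
    nth_rewrite 1 [← add_halves t]
    rw [← matPow_mul_matPow hσ]
    simp only [Matrix.mul_assoc]
  rw [e1, e2, charpoly_mul_comm]

theorem Matrix.PosSemidef.exists_conjTranspose_mul_self {A : Matrix n n ℂ} (hA : A.PosSemidef) :
    ∃ B : Matrix n n ℂ, A = Bᴴ * B := by
  refine ⟨matPow A (1 / 2), ?_⟩
  rw [(matPow_isHermitian hA.isHermitian _).eq, matPow_mul_matPow hA, add_halves,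
    matPow_eq hA.isHermitian]
  conv_lhs => rw [hA.isHermitian.eq_eigenvectorUnitary_conj]
  congr 3
  ext i
  split_ifs with h
  · rw [h]
  · rw [Real.rpow_one]

theorem Dtilde_re_mono {ρ σ : Matrix n n ℂ} (hρ : ρ.PosSemidef) (hσ : σ.PosSemidef)
    (hρσ : (ρ * σ).trace ≠ 0) {α β : ℝ} (hα : 0 < α) (hα1 : α ≠ 1) (hβ1 : β ≠ 1)
    (hαβ : α ≤ β) (hdom : dominates σ ρ ∨ β < 1) :
    (α - 1)⁻¹ * Real.logb 2
        ((matPow (matPow σ ((1 - α) / (2 * α)) * ρ * matPow σ ((1 - α) / (2 * α))) α).trace.re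
          / ρ.trace.re) ≤
    (β - 1)⁻¹ * Real.logb 2
        ((matPow (matPow σ ((1 - β) / (2 * β)) * ρ * matPow σ ((1 - β) / (2 * β))) β).trace.re
          / ρ.trace.re) := by
  have hβ := hα.trans_le hαβ
  obtain ⟨B, rfl⟩ := hρ.exists_conjTranspose_mul_self
  have hhalf : ∀ γ : ℝ, (1 - γ) / (2 * γ) = (1 - γ) / γ / 2 := fun γ => by
    rw [div_div, mul_comm γ]
  rw [hhalf, hhalf, trace_matPow_sandwich hσ B hα.ne', trace_matPow_sandwich hσ B hβ.ne']
  have hX : ∀ γ : ℝ, (B * matPow σ ((1 - γ) / γ) * Bᴴ).PosSemidef :=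
    fun γ => posSemidef_mul_matPow_mul_conjTranspose hσ B ((1 - γ) / γ)
  set l := hσ.isHermitian.eigenvalues with hl_def
  have hl : ∀ j, 0 ≤ l j := hσ.eigenvalues_nonneg
  set V : Matrix n n ℂ := ↑hσ.isHermitian.eigenvectorUnitary
  set W : Matrix n n ℂ := ↑(hX α).isHermitian.eigenvectorUnitary with hW_def
  have hW1 : Wᴴ * W = 1 := (hX α).isHermitian.eigenvectorUnitary_conjTranspose_mul_self
  have hW2 : W * Wᴴ = 1 := (hX α).isHermitian.eigenvectorUnitary_mul_conjTranspose_self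
  have hV2 : V * Vᴴ = 1 := hσ.isHermitian.eigenvectorUnitary_mul_conjTranspose_self
  set N : Matrix n n ℂ := Vᴴ * Bᴴ * W with hN
  set p : n → n → ℝ := fun i j => Complex.normSq (N j i) with hp_def
  have hp : ∀ i j, 0 ≤ p i j := fun i j => Complex.normSq_nonneg _
  have hNd : ∀ d : n → ℝ, Nᴴ * diagonal (fun j => (d j : ℂ)) * N =
      Wᴴ * (B * (V * diagonal (fun j => (d j : ℂ)) * Vᴴ) * Bᴴ) * W := fun d => by
    simp only [hN, conjTranspose_mul, conjTranspose_conjTranspose, Matrix.mul_assoc]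
  have htr : ∀ d : n → ℝ, (Bᴴ * B * (V * diagonal (fun j => (d j : ℂ)) * Vᴴ)).trace =
      ((∑ i, ∑ j, p i j * d j : ℝ) : ℂ) := by
    intro d
    have h1 : (Nᴴ * diagonal (fun j => (d j : ℂ)) * N).trace =
        ((∑ i, ∑ j, p i j * d j : ℝ) : ℂ) := by
      rw [Complex.ofReal_sum]
      exact Finset.sum_congr rfl fun i _ => conjTranspose_mul_diagonal_mul_apply_self N d i
    rw [← h1, hNd, Matrix.trace_mul_comm (Wᴴ * _), ← Matrix.mul_assoc W, hW2, Matrix.one_mul,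
      Matrix.trace_mul_comm (B * _), ← Matrix.mul_assoc Bᴴ]
  have htrρ : (Bᴴ * B).trace.re = ∑ i, ∑ j, p i j := by
    have h := htr fun _ => 1
    simp only [Complex.ofReal_one, Matrix.diagonal_one, hV2, mul_one] at h
    rw [h, Complex.ofReal_re]
  have hσV : σ = V * diagonal (fun j => (l j : ℂ)) * Vᴴ :=
    hσ.isHermitian.eq_eigenvectorUnitary_conj
  have hne : ∃ i j, 0 < p i j * l j := by
    by_contra! hcon
    refine hρσ ?_
    rw [hσV, htr, Complex.ofReal_eq_zero]
    exact Finset.sum_eq_zero fun i _ => Finset.sum_eq_zero fun j _ =>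
      (hcon i j).antisymm (mul_nonneg (hp i j) (hl j))
  have hsupp : β < 1 ∨ ∀ i j, p i j ≠ 0 → 0 < l j := by
    refine hdom.symm.imp_right fun h i j hij => (hl j).lt_of_ne' fun hj => hij ?_
    have h1 := h _ (by
      rw [hσ.isHermitian.mulVec_eigenvectorBasis j, ← hl_def, hj, zero_smul])
    have h2 := (Matrix.conjTranspose_mul_self_mulVec_eq_zero B _).1 h1
    have h3 : ∀ k, (B * V) k j = 0 := fun k => congrFun h2 k
    have h4 : N j i = 0 := by
      have : N = (B * V)ᴴ * W := by rw [hN, conjTranspose_mul]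
      rw [this, Matrix.mul_apply]
      exact Finset.sum_eq_zero fun k _ => by rw [Matrix.conjTranspose_apply, h3]; simp
    simp [hp_def, h4]
  have hdiag : ∀ γ : ℝ, 0 < γ → γ ≤ β → ∀ i,
      ((Wᴴ * (B * matPow σ ((1 - γ) / γ) * Bᴴ) * W) i i).re =
        ∑ j, p i j * l j ^ ((1 - γ) / γ) := by
    intro γ hγ hγβ i
    rw [matPow_eq hσ.isHermitian, ← hNd, conjTranspose_mul_diagonal_mul_apply_self,
      Complex.ofReal_re]
    refine Finset.sum_congr rfl fun j _ => ?_
    split_ifs with h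
    · rcases hsupp with hβ' | hs
      · rw [← hl_def] at h
        rw [h, Real.zero_rpow (div_pos (by linarith) hγ).ne']
      · have : p i j = 0 := by
          by_contra h0
          exact (hs i j h0).ne' h
        simp only [hp_def] at this ⊢
        rw [this, zero_mul, zero_mul]
    · rfl
  have hα_eig : ∀ i, (hX α).isHermitian.eigenvalues i = ∑ j, p i j * l j ^ ((1 - α) / α) := by
    intro i
    rw [← hdiag α hα hαβ i]
    rw [hW_def, (hX α).isHermitian.eigenvectorUnitary_conj_eq_diagonal,
      Matrix.diagonal_apply_eq, Complex.ofReal_re]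
  simp only [hα_eig]
  rw [htrρ]
  refine (renyi_weights_mono hp hl hne hα hα1 hβ1 hαβ hsupp).trans ?_
  set y : n → ℝ := fun i => ∑ j, p i j * l j ^ ((1 - β) / β) with hy
  have hy0 : ∀ i, 0 ≤ y i := fun i =>
    Finset.sum_nonneg fun j _ => mul_nonneg (hp i j) (Real.rpow_nonneg (hl j) _)
  obtain ⟨a, b, hab⟩ := hne
  have hpab : 0 < p a b := (hp a b).lt_of_ne' fun h => by simp [h] at hab
  have hlb : 0 < l b := (hl b).lt_of_ne' fun h => by simp [h] at hab
  have hya : 0 < y a := Finset.sum_pos'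
    (fun j _ => mul_nonneg (hp a j) (Real.rpow_nonneg (hl j) _))
    ⟨b, Finset.mem_univ _, mul_pos hpab (Real.rpow_pos_of_pos hlb _)⟩
  have hP : 0 < ∑ i, ∑ j, p i j := Finset.sum_pos'
    (fun i _ => Finset.sum_nonneg fun j _ => hp i j)
    ⟨a, Finset.mem_univ _, Finset.sum_pos' (fun j _ => hp a j) ⟨b, Finset.mem_univ _, hpab⟩⟩
  have hpeierls : ∀ {f : ℝ → ℝ}, ConvexOn ℝ (Set.Ici 0) f →
      ∑ i, f (y i) ≤ ∑ i, f ((hX β).isHermitian.eigenvalues i) := by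
    intro f hf
    have h := sum_convexOn_diag_le_sum_eigenvalues (hX β) hW1 hf
    simpa only [hdiag β hβ le_rfl] using h
  rcases lt_or_gt_of_ne hβ1 with hβ' | hβ'
  · refine mul_le_mul_of_nonpos_left ?_ (inv_nonpos.2 (by linarith))
    have heig := (hX β).eigenvalues_nonneg
    refine Real.logb_le_logb_of_le one_lt_two (div_pos ?_ hP) (div_le_div_of_nonneg_right ?_ hP.le)
    · have h1 := hpeierls (convexOn_id (convex_Ici 0))
      have h2 : 0 < ∑ i, (hX β).isHermitian.eigenvalues i :=
        (Finset.sum_pos' (fun i _ => hy0 i) ⟨a, Finset.mem_univ _, hya⟩).trans_le h1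
      obtain ⟨k, -, hk⟩ := Finset.exists_ne_zero_of_sum_ne_zero h2.ne'
      exact Finset.sum_pos' (fun i _ => Real.rpow_nonneg (heig i) _)
        ⟨k, Finset.mem_univ _, Real.rpow_pos_of_pos ((heig k).lt_of_ne' hk) _⟩
    · have h := hpeierls (Real.concaveOn_rpow hβ.le hβ'.le).neg
      simpa only [Pi.neg_apply, Finset.sum_neg_distrib, neg_le_neg_iff] using h
  · refine mul_le_mul_of_nonneg_left ?_ (inv_nonneg.2 (by linarith))
    refine Real.logb_le_logb_of_le one_lt_two (div_pos ?_ hP)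
      (div_le_div_of_nonneg_right (hpeierls (convexOn_rpow hβ'.le)) hP.le)
    exact Finset.sum_pos' (fun i _ => Real.rpow_nonneg (hy0 i) _)
      ⟨a, Finset.mem_univ _, Real.rpow_pos_of_pos hya _⟩

end MatrixLemmas

/-- the sandwiched Rényi divergence is monotonically increasing in the
order `α` on `(0,1) ∪ (1,∞)`. -/
theorem stmt10 {n : ℕ} {ρ σ : Matrix (Fin n) (Fin n) ℂ}
    (hρ : ρ.PosSemidef) (hσ : σ.PosSemidef) (hρ0 : ρ ≠ 0)
    {α β : ℝ} (hα : α ∈ Set.Ioo (0 : ℝ) 1 ∪ Set.Ioi 1)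
    (hβ : β ∈ Set.Ioo (0 : ℝ) 1 ∪ Set.Ioi 1) (hαβ : α ≤ β) :
    Dtilde α ρ σ ≤ Dtilde β ρ σ := by
  have hα0 : 0 < α := hα.elim (fun h => h.1) fun h => zero_lt_one.trans h
  have hα1 : α ≠ 1 := hα.elim (fun h => h.2.ne) fun h => ne_of_gt h
  have hβ1 : β ≠ 1 := hβ.elim (fun h => h.2.ne) fun h => ne_of_gt h
  by_cases hcond : (ρ * σ).trace ≠ 0 ∧ (dominates σ ρ ∨ β < 1)
  · rw [Dtilde, Dtilde, if_pos hcond,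
      if_pos ⟨hcond.1, hcond.2.imp_right fun h => hαβ.trans_lt h⟩, EReal.coe_le_coe_iff]
    exact Dtilde_re_mono hρ hσ hcond.1 hα0 hα1 hβ1 hαβ hcond.2
  · rw [Dtilde.eq_1 β, if_neg hcond]
    exact le_top
end

section
/- Let X be a nonzero positive semidefinite complex n×n matrix and let p, q ∈ ℝ \ {0, 1} satisfy 1/p + 1/q = 1. If p > 1, then (Tr[X^p])^(1/p) = sup { Tr[X · Z^(1/q)] : Z positive semidefinite, Tr[Z] ≤ 1 }. If 0 < p < 1, then (Tr[X^p])^(1/p) = inf { Tr[X · Z^(1/q)] : Z positive semidefinite, Tr[Z] ≤ 1, and the kernel of Z is contained in the kernel of X }. -/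
open Matrix
open scoped Kronecker Classical ComplexOrder

/-- The Hermitian matrix with real eigenvalues `d` in the orthonormal basis given by the columns
of the unitary `U`. -/
noncomputable def unitaryConjDiag {n : Type*} [Fintype n] [DecidableEq n]
    (U : unitaryGroup n ℂ) (d : n → ℝ) : Matrix n n ℂ :=
  (U : Matrix n n ℂ) * diagonal (fun i => (d i : ℂ)) * star (U : Matrix n n ℂ)

/-- The scalar function applied to eigenvalues by `matPow`. -/
noncomputable def supportRpow (t x : ℝ) : ℝ := if x = 0 then 0 else x ^ t

section

variable {n : Type*} [Fintype n] [DecidableEq n]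

theorem matPow_eq_unitaryConjDiag {A : Matrix n n ℂ} (hA : A.IsHermitian) (t : ℝ) :
    matPow A t =
      unitaryConjDiag hA.eigenvectorUnitary (fun i => supportRpow t (hA.eigenvalues i)) := by
  simp only [matPow, dif_pos hA, unitaryConjDiag, supportRpow]

theorem Matrix.IsHermitian.eq_unitaryConjDiag {A : Matrix n n ℂ} (hA : A.IsHermitian) :
    A = unitaryConjDiag hA.eigenvectorUnitary hA.eigenvalues := by
  conv_lhs => rw [hA.spectral_theorem]
  rfl

theorem trace_unitaryConjDiag (U : unitaryGroup n ℂ) (d : n → ℝ) :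
    (unitaryConjDiag U d).trace = ((∑ i, d i : ℝ) : ℂ) := by
  rw [unitaryConjDiag, trace_mul_comm, ← mul_assoc, UnitaryGroup.star_mul_self, one_mul,
    trace_diagonal]
  push_cast
  rfl

theorem posSemidef_unitaryConjDiag (U : unitaryGroup n ℂ) {d : n → ℝ} (hd : ∀ i, 0 ≤ d i) :
    (unitaryConjDiag U d).PosSemidef := by
  have h : (diagonal (fun i => (d i : ℂ))).PosSemidef :=
    posSemidef_diagonal_iff.mpr fun i => by exact_mod_cast hd i
  exact h.mul_mul_conjTranspose_same (U : Matrix n n ℂ)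

theorem unitaryConjDiag_mulVec_eq_zero_iff (U : unitaryGroup n ℂ) (d : n → ℝ) (v : n → ℂ) :
    unitaryConjDiag U d *ᵥ v = 0 ↔ ∀ i, (d i : ℂ) * (star (U : Matrix n n ℂ) *ᵥ v) i = 0 := by
  have key : star (U : Matrix n n ℂ) *ᵥ (unitaryConjDiag U d *ᵥ v) =
      diagonal (fun i => (d i : ℂ)) *ᵥ (star (U : Matrix n n ℂ) *ᵥ v) := by
    rw [unitaryConjDiag, mulVec_mulVec, mulVec_mulVec, ← mul_assoc, ← mul_assoc,
      UnitaryGroup.star_mul_self, one_mul]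
  constructor
  · intro h i
    rw [h, mulVec_zero] at key
    have hi := congrFun key i
    rw [mulVec_diagonal] at hi
    exact hi.symm
  · intro h
    have h' : diagonal (fun i => (d i : ℂ)) *ᵥ (star (U : Matrix n n ℂ) *ᵥ v) = 0 := by
      ext i
      rw [mulVec_diagonal, h i]
      rfl
    rw [unitaryConjDiag, ← mulVec_mulVec, ← mulVec_mulVec, h', mulVec_zero]

theorem sum_normSq_row (M : unitaryGroup n ℂ) (i : n) :
    ∑ j, Complex.normSq (M.1 i j) = 1 := by
  have h := congrFun (congrFun (mem_unitaryGroup_iff.mp M.2) i) i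
  rw [mul_apply, one_apply_eq] at h
  have h2 : ((∑ j, Complex.normSq (M.1 i j) : ℝ) : ℂ) = 1 := by
    rw [← h]
    push_cast
    exact Finset.sum_congr rfl fun j _ => (Complex.mul_conj _).symm
  exact_mod_cast h2

theorem sum_normSq_col (M : unitaryGroup n ℂ) (j : n) :
    ∑ i, Complex.normSq (M.1 i j) = 1 := by
  simpa [star_apply] using sum_normSq_row (star M) j

theorem trace_unitaryConjDiag_mul (U V : unitaryGroup n ℂ) (d e : n → ℝ) :
    (unitaryConjDiag U d * unitaryConjDiag V e).trace.re =
      ∑ i, ∑ j, Complex.normSq ((star U * V).1 i j) * (d i * e j) := by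
  have h : (unitaryConjDiag U d * unitaryConjDiag V e).trace =
      (diagonal (fun i => (d i : ℂ)) * (star U * V).1 * diagonal (fun i => (e i : ℂ)) *
        star (star U * V).1).trace := by
    have hs : (star U * V).1 = star (U : Matrix n n ℂ) * (V : Matrix n n ℂ) := rfl
    rw [hs, star_mul, star_star, unitaryConjDiag, unitaryConjDiag]
    simp only [mul_assoc]
    rw [trace_mul_comm]
    simp only [mul_assoc]
  rw [h]
  rw [trace, Complex.re_sum]
  refine Finset.sum_congr rfl fun i _ => ?_
  rw [diag_apply, Matrix.mul_apply, Complex.re_sum]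
  refine Finset.sum_congr rfl fun j _ => ?_
  rw [mul_diagonal, diagonal_mul, star_apply, mul_right_comm, mul_assoc (d i : ℂ), ← starRingEnd_apply, Complex.mul_conj]
  norm_cast
  ring

/-- Two diagonalizations of one matrix only overlap on equal eigenvalues. -/
theorem eq_of_unitaryConjDiag_eq {U V : unitaryGroup n ℂ} {d e : n → ℝ}
    (h : unitaryConjDiag U d = unitaryConjDiag V e) {i j : n} (hij : (star U * V).1 i j ≠ 0) :
    d i = e j := by
  have h1 : diagonal (fun i => (d i : ℂ)) * (star U * V).1 =
      (star U * V).1 * diagonal (fun i => (e i : ℂ)) := by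
    have hs : (star U * V).1 = star (U : Matrix n n ℂ) * (V : Matrix n n ℂ) := rfl
    have := congrArg (fun A => star (U : Matrix n n ℂ) * A * (V : Matrix n n ℂ)) h
    simp only [unitaryConjDiag] at this
    rw [hs]
    rw [← mul_assoc, ← mul_assoc, UnitaryGroup.star_mul_self, one_mul] at this
    simpa only [mul_assoc, UnitaryGroup.star_mul_self, mul_one] using this
  have h2 := congrFun (congrFun h1 i) j
  rw [diagonal_mul, mul_diagonal, mul_comm] at h2
  exact_mod_cast mul_left_cancel₀ hij h2

theorem trace_unitaryConjDiag_mul_matPow (U : unitaryGroup n ℂ) (d f : n → ℝ) (s : ℝ)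
    (hf : (unitaryConjDiag U f).IsHermitian) :
    (unitaryConjDiag U d * matPow (unitaryConjDiag U f) s).trace.re =
      ∑ i, d i * supportRpow s (f i) := by
  rw [matPow_eq_unitaryConjDiag hf, trace_unitaryConjDiag_mul]
  refine Finset.sum_congr rfl fun i _ => ?_
  rw [← one_mul (d i * _), ← sum_normSq_row (star U * hf.eigenvectorUnitary) i, Finset.sum_mul]
  refine Finset.sum_congr rfl fun j _ => ?_
  by_cases hij : (star U * hf.eigenvectorUnitary).1 i j = 0
  · simp [hij]
  · rw [eq_of_unitaryConjDiag_eq hf.eq_unitaryConjDiag hij]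

theorem sum_normSq_mul_add (M : unitaryGroup n ℂ) (a b : n → ℝ) :
    ∑ i, ∑ j, Complex.normSq (M.1 i j) * (a i + b j) = ∑ i, a i + ∑ j, b j := by
  simp only [mul_add, Finset.sum_add_distrib, ← Finset.sum_mul, sum_normSq_row, one_mul]
  rw [Finset.sum_comm]
  simp only [← Finset.sum_mul, sum_normSq_col, one_mul]

end

theorem supportRpow_nonneg (t : ℝ) {x : ℝ} (hx : 0 ≤ x) : 0 ≤ supportRpow t x := by
  unfold supportRpow
  split_ifs
  exacts [le_rfl, Real.rpow_nonneg hx t]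

theorem supportRpow_pos (t : ℝ) {x : ℝ} (hx : 0 < x) : 0 < supportRpow t x := by
  rw [supportRpow, if_neg hx.ne']
  exact Real.rpow_pos_of_pos hx t

theorem mul_supportRpow_le {p q x z T : ℝ} (hp : 1 < p) (hpq : 1 / p + 1 / q = 1)
    (hx : 0 ≤ x) (hz : 0 ≤ z) (hT : 0 < T) :
    x * supportRpow (1 / q) z ≤
      T ^ (1 / p) * (supportRpow p x / T * (1 / p) + z * (1 / q)) := by
  have hp0 : 0 < p := by linarith
  have hq : 0 ≤ 1 / q := by
    have : 1 / p ≤ 1 := (div_le_one hp0).mpr hp.le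
    linarith
  have hR : 0 ≤ T ^ (1 / p) := (Real.rpow_pos_of_pos hT _).le
  have hS := supportRpow_nonneg p hx
  by_cases hx0 : x = 0
  · rw [hx0, zero_mul]
    have := supportRpow_nonneg p (le_refl (0 : ℝ))
    positivity
  by_cases hz0 : z = 0
  · rw [supportRpow, if_pos hz0, mul_zero]
    positivity
  have hy := Real.geom_mean_le_arith_mean2_weighted (w₁ := 1 / p) (w₂ := 1 / q)
    (p₁ := x ^ p / T) (p₂ := z) (by positivity) hq (by positivity) hz hpq
  rw [Real.div_rpow (by positivity) hT.le, ← Real.rpow_mul hx, mul_one_div_cancel hp0.ne',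
    Real.rpow_one, div_mul_eq_mul_div, div_le_iff₀ (by positivity)] at hy
  rw [supportRpow, if_neg hz0, supportRpow, if_neg hx0]
  linarith

theorem le_mul_supportRpow {p q x z T : ℝ} (hp0 : 0 < p) (hp1 : p < 1)
    (hpq : 1 / p + 1 / q = 1) (hx : 0 ≤ x) (hz : 0 < z) (hT : 0 < T) :
    T ^ (1 / p) * (supportRpow p x / T * (1 / p) + z * (1 / q)) ≤
      x * supportRpow (1 / q) z := by
  have hs : 1 / q = 1 - 1 / p := by linarith
  have hR : 0 < T ^ (1 / p) := Real.rpow_pos_of_pos hT _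
  have hq : 1 / q < 0 := by
    have : 1 < 1 / p := (one_lt_div hp0).mpr hp1
    linarith
  by_cases hx0 : x = 0
  · rw [hx0, zero_mul, supportRpow, if_pos rfl]
    rw [zero_div, zero_mul, zero_add]
    exact mul_nonpos_of_nonneg_of_nonpos hR.le (mul_nonpos_of_nonneg_of_nonpos hz.le hq.le)
  have hx' : 0 < x := lt_of_le_of_ne hx (Ne.symm hx0)
  rw [supportRpow, if_neg hx0, supportRpow, if_neg hz.ne']
  set y := x * z ^ (1 / q) / T ^ (1 / p) with hy
  have hy0 : 0 < y := by positivity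
  have hg := Real.geom_mean_le_arith_mean2_weighted (w₁ := p) (w₂ := 1 - p)
    (p₁ := y) (p₂ := z) hp0.le (by linarith) hy0.le hz.le (by ring)
  have he : y ^ p * z ^ (1 - p) = x ^ p / T := by
    rw [hy, Real.div_rpow (by positivity) hR.le, Real.mul_rpow hx (by positivity),
      ← Real.rpow_mul hz.le, ← Real.rpow_mul hT.le, one_div_mul_cancel hp0.ne', Real.rpow_one,
      div_mul_eq_mul_div, mul_assoc, ← Real.rpow_add hz, hs]
    have : (1 - 1 / p) * p + (1 - p) = 0 := by field_simp; ring
    rw [this, Real.rpow_zero, mul_one]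
  rw [he] at hg
  have hxy : x * z ^ (1 / q) = T ^ (1 / p) * y := by rw [hy]; field_simp
  rw [hxy]
  refine mul_le_mul_of_nonneg_left ?_ hR.le
  have h2 := mul_le_mul_of_nonneg_right hg (one_div_pos.mpr hp0).le
  have h3 : (p * y + (1 - p) * z) * (1 / p) = y - z * (1 / q) := by rw [hs]; field_simp; ring
  linarith

theorem mul_supportRpow_supportRpow_div {p q x T : ℝ} (hp0 : p ≠ 0) (hpq : 1 / p + 1 / q = 1)
    (hx : 0 ≤ x) (hT : 0 < T) :
    x * supportRpow (1 / q) (supportRpow p x / T) = supportRpow p x * T ^ (-(1 / q)) := by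
  rcases hx.eq_or_lt with rfl | hx
  · simp [supportRpow]
  have hs : 1 / q = 1 - 1 / p := by linarith
  have h := div_pos (supportRpow_pos p hx) hT
  rw [supportRpow, if_neg h.ne', supportRpow, if_neg hx.ne', Real.div_rpow (by positivity) hT.le,
    ← Real.rpow_mul hx.le, Real.rpow_neg hT.le, ← div_eq_mul_inv, ← mul_div_assoc]
  congr 1
  nth_rewrite 1 [← Real.rpow_one x]
  rw [← Real.rpow_add hx, hs]
  congr 1
  field_simp
  ring

section

variable {n : Type*} [Fintype n] [DecidableEq n] {X Z : Matrix n n ℂ} {p q : ℝ}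

theorem trace_matPow_re_pos (hX : X.PosSemidef) (hX0 : X ≠ 0) (p : ℝ) :
    0 < (matPow X p).trace.re := by
  rw [matPow_eq_unitaryConjDiag hX.1, trace_unitaryConjDiag, Complex.ofReal_re]
  have hne : hX.1.eigenvalues ≠ 0 := fun h => hX0 (hX.1.eigenvalues_eq_zero_iff.mp h)
  obtain ⟨i, hi⟩ := Function.ne_iff.mp hne
  exact Finset.sum_pos' (fun i _ => supportRpow_nonneg p (hX.eigenvalues_nonneg i))
    ⟨i, Finset.mem_univ i, supportRpow_pos p (lt_of_le_of_ne (hX.eigenvalues_nonneg i) hi.symm)⟩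

theorem sum_normSq_mul_young (hX : X.PosSemidef) (hX0 : X ≠ 0) (hZ : Z.PosSemidef) (p q : ℝ) :
    ∑ i, ∑ j, Complex.normSq
        ((star hX.1.eigenvectorUnitary * hZ.1.eigenvectorUnitary).1 i j) *
        (((matPow X p).trace.re) ^ (1 / p) *
          (supportRpow p (hX.1.eigenvalues i) / (matPow X p).trace.re * (1 / p) +
            hZ.1.eigenvalues j * (1 / q))) =
      ((matPow X p).trace.re) ^ (1 / p) * (1 / p + Z.trace.re * (1 / q)) := by
  have hT := trace_matPow_re_pos hX hX0 p
  have hTX : ∑ i, supportRpow p (hX.1.eigenvalues i) = (matPow X p).trace.re := by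
    rw [matPow_eq_unitaryConjDiag hX.1, trace_unitaryConjDiag, Complex.ofReal_re]
  have hTZ : ∑ j, hZ.1.eigenvalues j = Z.trace.re := by
    conv_rhs => rw [hZ.1.eq_unitaryConjDiag, trace_unitaryConjDiag, Complex.ofReal_re]
  simp only [mul_left_comm _ (_ ^ (1 / p)), ← Finset.mul_sum]
  rw [sum_normSq_mul_add, ← Finset.sum_mul, ← Finset.sum_mul, ← Finset.sum_div, hTX, hTZ,
    div_self hT.ne', one_mul]

theorem trace_mul_matPow_re (hX : X.PosSemidef) (hZ : Z.PosSemidef) (s : ℝ) :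
    (X * matPow Z s).trace.re = ∑ i, ∑ j, Complex.normSq
        ((star hX.1.eigenvectorUnitary * hZ.1.eigenvectorUnitary).1 i j) *
        (hX.1.eigenvalues i * supportRpow s (hZ.1.eigenvalues j)) := by
  rw [matPow_eq_unitaryConjDiag hZ.1, ← trace_unitaryConjDiag_mul, ← hX.1.eq_unitaryConjDiag]

theorem trace_mul_matPow_le (hX : X.PosSemidef) (hX0 : X ≠ 0) (hp : 1 < p)
    (hpq : 1 / p + 1 / q = 1) (hZ : Z.PosSemidef) (hZ1 : Z.trace.re ≤ 1) :
    (X * matPow Z (1 / q)).trace.re ≤ ((matPow X p).trace.re) ^ (1 / p) := by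
  have hT := trace_matPow_re_pos hX hX0 p
  have hq : 0 ≤ 1 / q := by
    have : 1 / p ≤ 1 := (div_le_one (by linarith)).mpr hp.le
    linarith
  calc (X * matPow Z (1 / q)).trace.re
      ≤ ((matPow X p).trace.re) ^ (1 / p) * (1 / p + Z.trace.re * (1 / q)) := by
        rw [trace_mul_matPow_re hX hZ, ← sum_normSq_mul_young hX hX0 hZ]
        exact Finset.sum_le_sum fun i _ => Finset.sum_le_sum fun j _ =>
          mul_le_mul_of_nonneg_left
            (mul_supportRpow_le hp hpq (hX.eigenvalues_nonneg i) (hZ.eigenvalues_nonneg j) hT)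
            (Complex.normSq_nonneg _)
    _ ≤ _ := mul_le_of_le_one_right (Real.rpow_nonneg hT.le _) (by nlinarith)

theorem le_trace_mul_matPow (hX : X.PosSemidef) (hX0 : X ≠ 0) (hp0 : 0 < p) (hp1 : p < 1)
    (hpq : 1 / p + 1 / q = 1) (hZ : Z.PosSemidef) (hZ1 : Z.trace.re ≤ 1)
    (hZX : dominates Z X) :
    ((matPow X p).trace.re) ^ (1 / p) ≤ (X * matPow Z (1 / q)).trace.re := by
  have hT := trace_matPow_re_pos hX hX0 p
  have hq : 1 / q < 0 := by
    have : 1 < 1 / p := (one_lt_div hp0).mpr hp1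
    linarith
  calc ((matPow X p).trace.re) ^ (1 / p)
      ≤ ((matPow X p).trace.re) ^ (1 / p) * (1 / p + Z.trace.re * (1 / q)) :=
        le_mul_of_one_le_right (Real.rpow_nonneg hT.le _) (by nlinarith)
    _ ≤ (X * matPow Z (1 / q)).trace.re := by
        rw [trace_mul_matPow_re hX hZ, ← sum_normSq_mul_young hX hX0 hZ]
        refine Finset.sum_le_sum fun i _ => Finset.sum_le_sum fun j _ => ?_
        rcases (hZ.eigenvalues_nonneg j).eq_or_lt with hj | hj
        · have hker : Z *ᵥ (fun k => hZ.1.eigenvectorUnitary.1 k j) = 0 := by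
            have := hZ.1.mulVec_eigenvectorBasis j
            rw [← hj, zero_smul] at this
            exact this
          have hker' := hZX _ hker
          rw [hX.1.eq_unitaryConjDiag, unitaryConjDiag_mulVec_eq_zero_iff] at hker'
          rcases mul_eq_zero.mp (hker' i) with hi | hi
          · rw [Complex.ofReal_eq_zero] at hi
            simp [hi, ← hj, supportRpow]
          · have : (star hX.1.eigenvectorUnitary * hZ.1.eigenvectorUnitary).1 i j = 0 := hi
            simp [this]
        · exact mul_le_mul_of_nonneg_left
            (le_mul_supportRpow hp0 hp1 hpq (hX.eigenvalues_nonneg i) hj hT)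
            (Complex.normSq_nonneg _)

theorem exists_trace_mul_matPow_eq (hX : X.PosSemidef) (hX0 : X ≠ 0) (hp0 : p ≠ 0)
    (hpq : 1 / p + 1 / q = 1) :
    ∃ Z : Matrix n n ℂ, Z.PosSemidef ∧ Z.trace.re ≤ 1 ∧ dominates Z X ∧
      ((matPow X p).trace.re) ^ (1 / p) = (X * matPow Z (1 / q)).trace.re := by
  have hT := trace_matPow_re_pos hX hX0 p
  have hTX : ∑ i, supportRpow p (hX.1.eigenvalues i) = (matPow X p).trace.re := by
    rw [matPow_eq_unitaryConjDiag hX.1, trace_unitaryConjDiag, Complex.ofReal_re]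
  set T := (matPow X p).trace.re
  have hZ := posSemidef_unitaryConjDiag hX.1.eigenvectorUnitary
    (d := fun i => supportRpow p (hX.1.eigenvalues i) / T)
    fun i => div_nonneg (supportRpow_nonneg p (hX.eigenvalues_nonneg i)) hT.le
  refine ⟨_, hZ, ?_, ?_, ?_⟩
  · rw [trace_unitaryConjDiag, Complex.ofReal_re, ← Finset.sum_div, hTX, div_self hT.ne']
  · intro v hv
    rw [hX.1.eq_unitaryConjDiag]
    rw [unitaryConjDiag_mulVec_eq_zero_iff] at hv ⊢
    intro i
    rcases (hX.eigenvalues_nonneg i).eq_or_lt with hi | hi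
    · simp [← hi]
    · have h := div_pos (supportRpow_pos p hi) hT
      rw [(mul_eq_zero.mp (hv i)).resolve_left (by exact_mod_cast h.ne'), mul_zero]
  · have h := trace_unitaryConjDiag_mul_matPow _ hX.1.eigenvalues _ (1 / q) hZ.1
    rw [← hX.1.eq_unitaryConjDiag] at h
    rw [h, Finset.sum_congr rfl fun i _ =>
      mul_supportRpow_supportRpow_div hp0 hpq (hX.eigenvalues_nonneg i) hT, ← Finset.sum_mul, hTX]
    nth_rewrite 2 [← Real.rpow_one T]
    rw [← Real.rpow_add hT]
    congr 1
    linarith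

end

/-- variational characterization (duality) of the Schatten
`p`-(quasi)norm of a nonzero PSD matrix. -/
theorem stmt12 {n : ℕ} {X : Matrix (Fin n) (Fin n) ℂ}
    (hX : X.PosSemidef) (hX0 : X ≠ 0)
    {p q : ℝ} (hp0 : p ≠ 0) (hp1 : p ≠ 1) (hq0 : q ≠ 0) (hq1 : q ≠ 1)
    (hpq : 1 / p + 1 / q = 1) :
    (1 < p → ((matPow X p).trace.re) ^ (1 / p) =
      sSup {r : ℝ | ∃ Z : Matrix (Fin n) (Fin n) ℂ,
        Z.PosSemidef ∧ Z.trace.re ≤ 1 ∧ r = ((X * matPow Z (1 / q)).trace).re}) ∧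
    (0 < p → p < 1 → ((matPow X p).trace.re) ^ (1 / p) =
      sInf {r : ℝ | ∃ Z : Matrix (Fin n) (Fin n) ℂ,
        Z.PosSemidef ∧ Z.trace.re ≤ 1 ∧ dominates Z X ∧
        r = ((X * matPow Z (1 / q)).trace).re}) := by
  obtain ⟨Z, hZ, hZ1, hZX, hZeq⟩ := exists_trace_mul_matPow_eq hX hX0 hp0 hpq
  refine ⟨fun hp => ?_, fun hp hp' => ?_⟩
  · symm
    refine IsGreatest.csSup_eq ⟨⟨Z, hZ, hZ1, hZeq⟩, ?_⟩
    rintro r ⟨Y, hY, hY1, rfl⟩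
    exact trace_mul_matPow_le hX hX0 hp hpq hY hY1
  · symm
    refine IsLeast.csInf_eq ⟨⟨Z, hZ, hZ1, hZX, hZeq⟩, ?_⟩
    rintro r ⟨Y, hY, hY1, hYX, rfl⟩
    exact le_trace_mul_matPow hX hX0 hp hp' hpq hY hY1 hYX
end

section
/- Let α, β ∈ (1/2, 1) ∪ (1, ∞) with 1/α + 1/β = 2, and let ρ_ABC = |φ⟩⟨φ| be the rank-one positive semidefinite matrix associated to a unit vector φ ∈ ℂ^(d_A) ⊗ ℂ^(d_B) ⊗ ℂ^(d_C), so Tr[ρ_ABC] = 1. Let ρ_AB be the partial trace of ρ_ABC over C and ρ_AC the partial trace over B. Then the duality relation H̃_α(A|B)_{ρ_AB} = − H̃_β(A|C)_{ρ_AC} holds. -/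
open Matrix
open scoped Kronecker Classical ComplexOrder

/-- The conditional Rényi entropy of order `α` of a bipartite state `ρ` on `A × B`:
the supremum over nonzero positive semidefinite `σ` on `B` with trace at most `1` of
`-D̃_α(ρ ‖ 1_A ⊗ σ)`. -/
noncomputable def condH {A B : Type*} [Fintype A] [DecidableEq A] [Fintype B] [DecidableEq B]
    (α : ℝ) (ρ : Matrix (A × B) (A × B) ℂ) : ℝ :=
  sSup {x : ℝ | ∃ σ : Matrix B B ℂ, σ.PosSemidef ∧ σ ≠ 0 ∧ σ.trace.re ≤ 1 ∧
    (x : EReal) = - Dtilde α ρ ((1 : Matrix A A ℂ) ⊗ₖ σ)}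

namespace Matrix

variable {m n : Type*} [Fintype m] [DecidableEq m] [Fintype n] [DecidableEq n]

/-- The power function with the convention that `0` is mapped to `0` for every exponent. -/
noncomputable def supportPow (t x : ℝ) : ℝ := if x = 0 then 0 else x ^ t

@[simp] lemma supportPow_zero_right (t : ℝ) : supportPow t 0 = 0 := by simp [supportPow]

lemma supportPow_of_ne_zero (t : ℝ) {x : ℝ} (hx : x ≠ 0) : supportPow t x = x ^ t := by
  simp [supportPow, hx]

lemma supportPow_eq_rpow {t : ℝ} (ht : t ≠ 0) (x : ℝ) : supportPow t x = x ^ t := by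
  rcases eq_or_ne x 0 with rfl | hx
  · simp [Real.zero_rpow ht]
  · exact supportPow_of_ne_zero t hx

lemma supportPow_nonneg (t : ℝ) {x : ℝ} (hx : 0 ≤ x) : 0 ≤ supportPow t x := by
  unfold supportPow; split_ifs <;> positivity

lemma supportPow_mul (s t : ℝ) {x : ℝ} (hx : 0 ≤ x) :
    supportPow s x * supportPow t x = supportPow (s + t) x := by
  rcases hx.eq_or_lt with rfl | hx
  · simp
  · simp [supportPow_of_ne_zero _ hx.ne', Real.rpow_add hx]

lemma supportPow_supportPow (s t : ℝ) {x : ℝ} (hx : 0 ≤ x) :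
    supportPow t (supportPow s x) = supportPow (s * t) x := by
  rcases hx.eq_or_lt with rfl | hx
  · simp
  · simp [supportPow_of_ne_zero _ hx.ne', supportPow_of_ne_zero _ (Real.rpow_pos_of_pos hx s).ne',
      Real.rpow_mul hx.le]

namespace IsHermitian

variable {A : Matrix n n ℂ} (hA : A.IsHermitian)
include hA

lemma continuousOn_spectrum (f : ℝ → ℝ) : ContinuousOn f (spectrum ℝ A) := by
  rw [hA.spectrum_real_eq_range_eigenvalues]
  exact (Set.finite_range _).continuousOn _

lemma continuousOn_image_spectrum (f g : ℝ → ℝ) : ContinuousOn f (g '' spectrum ℝ A) := by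
  rw [hA.spectrum_real_eq_range_eigenvalues]
  exact ((Set.finite_range _).image _).continuousOn _

lemma matPow_eq_cfc (t : ℝ) : matPow A t = cfc (supportPow t) A := by
  rw [hA.cfc_eq, matPow, dif_pos hA, IsHermitian.cfc, Unitary.conjStarAlgAut_apply]
  rfl

lemma cfc_congr_eigenvalues {f g : ℝ → ℝ} (h : ∀ i, f (hA.eigenvalues i) = g (hA.eigenvalues i)) :
    cfc f A = cfc g A := by
  apply cfc_congr
  rw [hA.spectrum_real_eq_range_eigenvalues]
  rintro _ ⟨i, rfl⟩
  exact h i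

lemma cfc_mul_cfc (f g : ℝ → ℝ) : cfc f A * cfc g A = cfc (fun x ↦ f x * g x) A :=
  (cfc_mul f g A (hA.continuousOn_spectrum f) (hA.continuousOn_spectrum g)).symm

lemma cfc_cfc (f g : ℝ → ℝ) : cfc g (cfc f A) = cfc (fun x ↦ g (f x)) A :=
  (cfc_comp g f A hA (hA.continuousOn_image_spectrum g f) (hA.continuousOn_spectrum f)).symm

lemma cfc_id_fun : cfc (fun x : ℝ ↦ x) A = A := cfc_id' ℝ A hA

lemma cfc_one_fun : cfc (fun _ : ℝ ↦ 1) A = 1 := cfc_const_one ℝ A hA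

omit hA in
lemma isHermitian_cfc (f : ℝ → ℝ) : (cfc f A).IsHermitian := cfc_predicate f A

lemma matPow_cfc (f : ℝ → ℝ) (t : ℝ) :
    matPow (cfc f A) t = cfc (fun x ↦ supportPow t (f x)) A := by
  rw [(isHermitian_cfc f).matPow_eq_cfc, hA.cfc_cfc]

lemma trace_cfc (f : ℝ → ℝ) : (cfc f A).trace = ((∑ i, f (hA.eigenvalues i) : ℝ) : ℂ) := by
  rw [hA.cfc_eq, IsHermitian.cfc, Unitary.conjStarAlgAut_apply, trace_mul_cycle,
    Unitary.coe_star_mul_self, one_mul, trace_diagonal]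
  simp

lemma posSemidef_cfc (f : ℝ → ℝ) (hf : ∀ i, 0 ≤ f (hA.eigenvalues i)) : (cfc f A).PosSemidef := by
  rw [hA.cfc_eq, IsHermitian.cfc, Unitary.conjStarAlgAut_apply]
  apply PosSemidef.mul_mul_conjTranspose_same
  rw [posSemidef_diagonal_iff]
  intro i
  simpa using hf i

end IsHermitian

/-- The trace of the `t`-th power of a matrix, as a real number. -/
noncomputable def powTrace (t : ℝ) (A : Matrix n n ℂ) : ℝ := (matPow A t).trace.re

lemma IsHermitian.powTrace_eq {A : Matrix n n ℂ} (hA : A.IsHermitian) (t : ℝ) :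
    powTrace t A = ∑ i, supportPow t (hA.eigenvalues i) := by
  rw [powTrace, hA.matPow_eq_cfc, hA.trace_cfc, Complex.ofReal_re]

lemma IsHermitian.powTrace_cfc {A : Matrix n n ℂ} (hA : A.IsHermitian) (f : ℝ → ℝ) (t : ℝ) :
    powTrace t (cfc f A) = ∑ i, supportPow t (f (hA.eigenvalues i)) := by
  rw [powTrace, hA.matPow_cfc, hA.trace_cfc, Complex.ofReal_re]

namespace PosSemidef

variable {A : Matrix n n ℂ} (hA : A.PosSemidef)
include hA

lemma matPow (t : ℝ) : (_root_.matPow A t).PosSemidef := by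
  rw [hA.1.matPow_eq_cfc]
  exact hA.1.posSemidef_cfc _ fun i ↦ supportPow_nonneg _ (hA.eigenvalues_nonneg i)

lemma matPow_mul_matPow (s t : ℝ) :
    _root_.matPow A s * _root_.matPow A t = _root_.matPow A (s + t) := by
  simp only [hA.1.matPow_eq_cfc, hA.1.cfc_mul_cfc]
  exact hA.1.cfc_congr_eigenvalues fun i ↦ supportPow_mul _ _ (hA.eigenvalues_nonneg i)

lemma matPow_one : _root_.matPow A 1 = A := by
  rw [hA.1.matPow_eq_cfc]
  conv_rhs => rw [← hA.1.cfc_id_fun]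
  exact hA.1.cfc_congr_eigenvalues fun i ↦ by simp [supportPow_eq_rpow one_ne_zero]

lemma matPow_matPow (s t : ℝ) :
    _root_.matPow (_root_.matPow A s) t = _root_.matPow A (s * t) := by
  rw [hA.1.matPow_eq_cfc, hA.1.matPow_cfc, hA.1.matPow_eq_cfc]
  exact hA.1.cfc_congr_eigenvalues fun i ↦ supportPow_supportPow _ _ (hA.eigenvalues_nonneg i)

lemma powTrace_nonneg (t : ℝ) : 0 ≤ powTrace t A := by
  rw [hA.1.powTrace_eq]
  exact Finset.sum_nonneg fun i _ ↦ supportPow_nonneg _ (hA.eigenvalues_nonneg i)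

lemma powTrace_one : powTrace 1 A = A.trace.re := by
  rw [powTrace, hA.matPow_one]

lemma powTrace_matPow (s t : ℝ) : powTrace t (_root_.matPow A s) = powTrace (s * t) A := by
  rw [powTrace, hA.matPow_matPow, powTrace]

lemma powTrace_pos (t : ℝ) (h0 : A ≠ 0) : 0 < powTrace t A := by
  rw [hA.1.powTrace_eq]
  obtain ⟨i, hi⟩ : ∃ i, hA.1.eigenvalues i ≠ 0 := by
    by_contra! h
    exact h0 (hA.1.eigenvalues_eq_zero_iff.mp (funext h))
  have hi' := (hA.eigenvalues_nonneg i).lt_of_ne' hi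
  refine Finset.sum_pos' (fun i _ ↦ supportPow_nonneg _ (hA.eigenvalues_nonneg i))
    ⟨i, Finset.mem_univ _, ?_⟩
  rw [supportPow_of_ne_zero _ hi]
  exact Real.rpow_pos_of_pos hi' t

end PosSemidef

namespace PosDef

variable {A : Matrix n n ℂ} (hA : A.PosDef)
include hA

lemma matPow_zero : _root_.matPow A 0 = 1 := by
  rw [hA.1.matPow_eq_cfc, ← hA.1.cfc_one_fun]
  exact hA.1.cfc_congr_eigenvalues fun i ↦ by
    simp [supportPow_of_ne_zero _ (hA.eigenvalues_pos i).ne']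

lemma matPow_mul_matPow_neg (t : ℝ) : _root_.matPow A t * _root_.matPow A (-t) = 1 := by
  rw [hA.posSemidef.matPow_mul_matPow, add_neg_cancel, hA.matPow_zero]

lemma matPow_neg_one : _root_.matPow A (-1) = A⁻¹ := by
  refine (Matrix.inv_eq_right_inv ?_).symm
  have := hA.matPow_mul_matPow_neg 1
  rwa [hA.posSemidef.matPow_one] at this

lemma matPow (t : ℝ) : (_root_.matPow A t).PosDef := by
  refine (hA.posSemidef.matPow t).posDef_iff_isUnit.mpr ?_
  exact IsUnit.of_mul_eq_one _ (hA.matPow_mul_matPow_neg t)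

end PosDef

open Polynomial in
lemma IsHermitian.powTrace_eq_roots {A : Matrix n n ℂ} (hA : A.IsHermitian) (t : ℝ) :
    powTrace t A = (A.charpoly.roots.map fun z : ℂ ↦ supportPow t z.re).sum := by
  rw [hA.powTrace_eq, hA.roots_charpoly_eq_eigenvalues, Multiset.map_map]
  simp [Function.comp_def]

lemma powTrace_transpose {A : Matrix n n ℂ} (hA : A.IsHermitian) (t : ℝ) :
    powTrace t Aᵀ = powTrace t A := by
  rw [hA.transpose.powTrace_eq_roots, hA.powTrace_eq_roots, charpoly_transpose]

open Polynomial in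
lemma powTrace_mul_conjTranspose (M : Matrix m n ℂ) (t : ℝ) :
    powTrace t (M * Mᴴ) = powTrace t (Mᴴ * M) := by
  rw [(isHermitian_mul_conjTranspose_self M).powTrace_eq_roots,
    (isHermitian_conjTranspose_mul_self M).powTrace_eq_roots]
  have h := congrArg (fun p : ℂ[X] ↦ (p.roots.map fun z : ℂ ↦ supportPow t z.re).sum)
    (charpoly_mul_comm' M Mᴴ)
  have key (k : ℕ) (p : ℂ[X]) (hp : p.Monic) :
      (((X ^ k * p).roots.map fun z : ℂ ↦ supportPow t z.re).sum)
        = (p.roots.map fun z : ℂ ↦ supportPow t z.re).sum := by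
    rw [roots_mul (mul_ne_zero (pow_ne_zero _ X_ne_zero) hp.ne_zero), roots_X_pow]
    simp [Multiset.map_nsmul, Multiset.sum_nsmul]
  simpa only [key _ _ (charpoly_monic _)] using h

/-- `A ↦ 1 ⊗ A` as a star algebra homomorphism. -/
noncomputable def oneKroneckerStarAlgHom (m n : Type*) [Fintype m] [DecidableEq m] [Fintype n]
    [DecidableEq n] : Matrix n n ℂ →⋆ₐ[ℝ] Matrix (m × n) (m × n) ℂ where
  toFun A := (1 : Matrix m m ℂ) ⊗ₖ A
  map_one' := one_kronecker_one
  map_mul' A B := by rw [← mul_kronecker_mul, one_mul]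
  map_zero' := kronecker_zero _
  map_add' A B := kronecker_add _ _ _
  commutes' r := by
    rw [Algebra.algebraMap_eq_smul_one, Algebra.algebraMap_eq_smul_one, kronecker_smul,
      one_kronecker_one]
  map_star' A := by
    rw [star_eq_conjTranspose, star_eq_conjTranspose, conjTranspose_kronecker, conjTranspose_one]

omit [Fintype m] [Fintype n] [DecidableEq n] in
lemma IsHermitian.one_kronecker {A : Matrix n n ℂ} (hA : A.IsHermitian) :
    ((1 : Matrix m m ℂ) ⊗ₖ A).IsHermitian := by
  rw [IsHermitian, conjTranspose_kronecker, conjTranspose_one, hA]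

lemma matPow_one_kronecker {A : Matrix n n ℂ} (hA : A.IsHermitian) (t : ℝ) :
    matPow ((1 : Matrix m m ℂ) ⊗ₖ A) t = (1 : Matrix m m ℂ) ⊗ₖ matPow A t := by
  rw [hA.one_kronecker.matPow_eq_cfc, hA.matPow_eq_cfc]
  have hcont : Continuous (oneKroneckerStarAlgHom m n) := by
    refine continuous_matrix fun i j ↦ ?_
    simp only [oneKroneckerStarAlgHom, StarAlgHom.coe_mk, kroneckerMap_apply]
    fun_prop
  exact ((oneKroneckerStarAlgHom m n).map_cfc (supportPow t) A (hA.continuousOn_spectrum _) hcont hA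
    hA.one_kronecker).symm

/-- The overlaps of the eigenvectors of two Hermitian matrices form a doubly stochastic matrix. -/
lemma exists_eigenvalues_overlap {X T : Matrix n n ℂ} (hX : X.IsHermitian) (hT : T.IsHermitian) :
    ∃ w : n → n → ℝ, (∀ i j, 0 ≤ w i j) ∧ (∀ i, ∑ j, w i j = 1) ∧ (∀ j, ∑ i, w i j = 1) ∧
      (X * T).trace = ((∑ i, ∑ j, w i j * (hX.eigenvalues i * hT.eigenvalues j) : ℝ) : ℂ) ∧
      (dominates T X → ∀ i j, hT.eigenvalues j = 0 → hX.eigenvalues i * w i j = 0) := by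
  set U : Matrix n n ℂ := (hX.eigenvectorUnitary : Matrix n n ℂ)
  set V : Matrix n n ℂ := (hT.eigenvectorUnitary : Matrix n n ℂ)
  have hU1 : Uᴴ * U = 1 := Unitary.coe_star_mul_self hX.eigenvectorUnitary
  have hU2 : U * Uᴴ = 1 := Unitary.coe_mul_star_self hX.eigenvectorUnitary
  have hV1 : Vᴴ * V = 1 := Unitary.coe_star_mul_self hT.eigenvectorUnitary
  have hV2 : V * Vᴴ = 1 := Unitary.coe_mul_star_self hT.eigenvectorUnitary
  have hXs : X = U * diagonal (fun i ↦ (hX.eigenvalues i : ℂ)) * Uᴴ := by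
    conv_lhs => rw [hX.spectral_theorem, Unitary.conjStarAlgAut_apply]
    rfl
  have hTs : T = V * diagonal (fun i ↦ (hT.eigenvalues i : ℂ)) * Vᴴ := by
    conv_lhs => rw [hT.spectral_theorem, Unitary.conjStarAlgAut_apply]
    rfl
  set W := Uᴴ * V with hW
  have hW1 : W * Wᴴ = 1 := by
    rw [hW, conjTranspose_mul, conjTranspose_conjTranspose, Matrix.mul_assoc, ← Matrix.mul_assoc V,
      hV2, Matrix.one_mul, hU1]
  have hW2 : Wᴴ * W = 1 := by
    rw [hW, conjTranspose_mul, conjTranspose_conjTranspose, Matrix.mul_assoc, ← Matrix.mul_assoc U,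
      hU2, Matrix.one_mul, hV1]
  refine ⟨fun i j ↦ Complex.normSq (W i j), fun i j ↦ Complex.normSq_nonneg _, fun i ↦ ?_,
    fun j ↦ ?_, ?_, fun hdom i j hj ↦ ?_⟩
  · have := congrFun (congrFun hW1 i) i
    simp only [mul_apply, conjTranspose_apply, one_apply_eq, Complex.star_def, Complex.mul_conj]
      at this
    exact_mod_cast this
  · have := congrFun (congrFun hW2 j) j
    simp only [mul_apply, conjTranspose_apply, one_apply_eq, Complex.star_def,
      ← Complex.normSq_eq_conj_mul_self] at this
    exact_mod_cast this
  · have h1 : (X * T).trace = (diagonal (fun i ↦ (hX.eigenvalues i : ℂ)) * W *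
        diagonal (fun i ↦ (hT.eigenvalues i : ℂ)) * Wᴴ).trace := by
      conv_lhs => rw [hXs, hTs]
      rw [hW, conjTranspose_mul, conjTranspose_conjTranspose]
      simp only [Matrix.mul_assoc]
      rw [trace_mul_comm U]
      simp only [Matrix.mul_assoc]
    rw [h1]
    simp only [trace, diag_apply, mul_apply (M := _ * _ * _), mul_diagonal, diagonal_mul,
      conjTranspose_apply, Complex.star_def]
    push_cast
    refine Finset.sum_congr rfl fun i _ ↦ Finset.sum_congr rfl fun j _ ↦ ?_
    rw [← Complex.mul_conj]
    ring
  · have hTv : T *ᵥ (fun k ↦ V k j) = 0 := by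
      have : T * V = V * diagonal (fun i ↦ (hT.eigenvalues i : ℂ)) := by
        conv_lhs => rw [hTs]
        rw [Matrix.mul_assoc, hV1, Matrix.mul_one]
      ext k
      have hk := congrFun (congrFun this k) j
      rw [mul_diagonal, hj] at hk
      simpa [mul_apply, mulVec, dotProduct] using hk
    have hXv := hdom _ hTv
    have hUX : diagonal (fun i ↦ (hX.eigenvalues i : ℂ)) * W = Uᴴ * (X * V) := by
      conv_rhs => rw [hXs]
      rw [hW]
      simp only [← Matrix.mul_assoc, hU1, Matrix.one_mul]
    have h0 := congrFun (congrFun hUX i) j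
    rw [diagonal_mul, mul_apply] at h0
    have : ∀ k, (X * V) k j = 0 := fun k ↦ by
      simpa [mul_apply, mulVec, dotProduct] using congrFun hXv k
    simp only [this, mul_zero, Finset.sum_const_zero, mul_eq_zero, Complex.ofReal_eq_zero] at h0
    rcases h0 with h0 | h0 <;> simp [h0]

lemma PosSemidef.trace_mul_nonneg {X T : Matrix n n ℂ} (hX : X.PosSemidef) (hT : T.PosSemidef) :
    0 ≤ (X * T).trace.re := by
  obtain ⟨w, hw, -, -, htr, -⟩ := exists_eigenvalues_overlap hX.1 hT.1
  rw [htr, Complex.ofReal_re]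
  exact Finset.sum_nonneg fun i _ ↦ Finset.sum_nonneg fun j _ ↦
    mul_nonneg (hw _ _) (mul_nonneg (hX.eigenvalues_nonneg _) (hT.eigenvalues_nonneg _))

/-- **Hölder's inequality** for the Schatten norms of positive semidefinite matrices. -/
lemma PosSemidef.trace_mul_le {X T : Matrix n n ℂ} (hX : X.PosSemidef) (hT : T.PosSemidef)
    {p q : ℝ} (hpq : p.HolderConjugate q) :
    (X * T).trace.re ≤ powTrace p X ^ (1 / p) * powTrace q T ^ (1 / q) := by
  obtain ⟨w, hw, hw1, hw2, htr, -⟩ := exists_eigenvalues_overlap hX.1 hT.1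
  have hx := hX.eigenvalues_nonneg
  have ht := hT.eigenvalues_nonneg
  have h := Real.inner_le_Lp_mul_Lq_of_nonneg (Finset.univ : Finset (n × n))
    (f := fun i ↦ w i.1 i.2 ^ (1 / p) * hX.1.eigenvalues i.1)
    (g := fun i ↦ w i.1 i.2 ^ (1 / q) * hT.1.eigenvalues i.2) hpq
    (fun i _ ↦ mul_nonneg (Real.rpow_nonneg (hw _ _) _) (hx _))
    (fun i _ ↦ mul_nonneg (Real.rpow_nonneg (hw _ _) _) (ht _))
  have hp0 := hpq.ne_zero
  have hq0 := hpq.symm.ne_zero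
  rw [htr, Complex.ofReal_re, hX.1.powTrace_eq, hT.1.powTrace_eq]
  convert h using 2
  · rw [Fintype.sum_prod_type]
    refine Finset.sum_congr rfl fun i _ ↦ Finset.sum_congr rfl fun j _ ↦ ?_
    have : w i j ^ (1 / p) * w i j ^ (1 / q) = w i j := by
      rw [← Real.rpow_add' (hw i j)]
      · simp [hpq.inv_add_inv_eq_one]
      · simp [hpq.inv_add_inv_eq_one]
    rw [mul_mul_mul_comm, this]
  · congr 1
    rw [Fintype.sum_prod_type]
    refine Finset.sum_congr rfl fun i _ ↦ ?_
    simp_rw [Real.mul_rpow (Real.rpow_nonneg (hw _ _) _) (hx _), ← Real.rpow_mul (hw _ _),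
      one_div, inv_mul_cancel₀ hp0, Real.rpow_one]
    rw [← Finset.sum_mul, hw1, one_mul, supportPow_eq_rpow hp0]
  · congr 1
    rw [Fintype.sum_prod_type_right]
    refine Finset.sum_congr rfl fun j _ ↦ ?_
    simp_rw [Real.mul_rpow (Real.rpow_nonneg (hw _ _) _) (ht _), ← Real.rpow_mul (hw _ _),
      one_div, inv_mul_cancel₀ hq0, Real.rpow_one]
    rw [← Finset.sum_mul, hw2, one_mul, supportPow_eq_rpow hq0]

/-- The **reverse Hölder inequality** for positive semidefinite matrices. -/
lemma PosSemidef.powTrace_rpow_le_trace_mul {X T : Matrix n n ℂ} (hX : X.PosSemidef)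
    (hT : T.PosSemidef) (hdom : dominates T X) {b g : ℝ} (hb0 : 0 < b) (hb1 : b < 1)
    (hg : b * g = 1 - b) :
    powTrace b X ^ (1 / b) ≤ (X * T).trace.re * powTrace (-g⁻¹) T ^ g := by
  obtain ⟨w, hw, hw1, hw2, htr, hker⟩ := exists_eigenvalues_overlap hX.1 hT.1
  have hker := hker hdom
  have hx := hX.eigenvalues_nonneg
  have ht := hT.eigenvalues_nonneg
  set x := hX.1.eigenvalues
  set t := hT.1.eigenvalues
  have hb2 : 0 < 1 - b := by linarith
  have hg0 : 0 < g := by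
    by_contra! h
    nlinarith
  have hconj : (1 / b).HolderConjugate (1 / (1 - b)) := by
    rw [Real.holderConjugate_iff]
    exact ⟨by rw [lt_div_iff₀ hb0]; linarith, by simp⟩
  have h := Real.inner_le_Lp_mul_Lq_of_nonneg (Finset.univ : Finset (n × n))
    (f := fun i ↦ (w i.1 i.2 * (x i.1 * t i.2)) ^ b)
    (g := fun i ↦ (w i.1 i.2 * supportPow (-g⁻¹) (t i.2)) ^ (1 - b)) hconj
    (fun i _ ↦ Real.rpow_nonneg (mul_nonneg (hw _ _) (mul_nonneg (hx _) (ht _))) _)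
    (fun i _ ↦ Real.rpow_nonneg (mul_nonneg (hw _ _) (supportPow_nonneg _ (ht _))) _)
  have e1 : ∑ i : n × n, (w i.1 i.2 * (x i.1 * t i.2)) ^ b *
      (w i.1 i.2 * supportPow (-g⁻¹) (t i.2)) ^ (1 - b) = powTrace b X := by
    rw [hX.1.powTrace_eq, Fintype.sum_prod_type]
    refine Finset.sum_congr rfl fun i _ ↦ ?_
    rw [supportPow_eq_rpow hb0.ne']
    trans (∑ j, w i j) * x i ^ b
    swap
    · rw [hw1, one_mul]
    rw [Finset.sum_mul]
    refine Finset.sum_congr rfl fun j _ ↦ ?_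
    dsimp only
    rcases (ht j).eq_or_lt' with h0 | h0
    · rw [h0, supportPow_zero_right, mul_zero, mul_zero, Real.zero_rpow hb2.ne', mul_zero]
      rcases mul_eq_zero.mp (hker i j h0) with h1 | h1
      · change 0 = w i j * x i ^ b
        rw [h1, Real.zero_rpow hb0.ne', mul_zero]
      · rw [h1, zero_mul]
    · rw [supportPow_of_ne_zero _ h0.ne', Real.mul_rpow (hw _ _) (mul_nonneg (hx _) (ht _)),
        Real.mul_rpow (hw _ _) (Real.rpow_nonneg h0.le _), Real.mul_rpow (hx _) (ht _),
        ← Real.rpow_mul h0.le]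
      have h2 : w i j ^ b * w i j ^ (1 - b) = w i j := by
        rw [← Real.rpow_add' (hw i j)] <;> simp
      have h3 : t j ^ b * t j ^ (-g⁻¹ * (1 - b)) = 1 := by
        rw [← Real.rpow_add h0, ← hg]
        field_simp
        simp
      calc _ = (w i j ^ b * w i j ^ (1 - b)) * x i ^ b * (t j ^ b * t j ^ (-g⁻¹ * (1 - b))) := by
            ring
        _ = _ := by rw [h2, h3, mul_one]
  have e2 : ∑ i : n × n, ((w i.1 i.2 * (x i.1 * t i.2)) ^ b) ^ (1 / b) = (X * T).trace.re := by
    rw [htr, Complex.ofReal_re, Fintype.sum_prod_type]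
    refine Finset.sum_congr rfl fun i _ ↦ Finset.sum_congr rfl fun j _ ↦ ?_
    rw [← Real.rpow_mul (mul_nonneg (hw _ _) (mul_nonneg (hx _) (ht _))), mul_one_div_cancel hb0.ne',
      Real.rpow_one]
  have e3 : ∑ i : n × n, ((w i.1 i.2 * supportPow (-g⁻¹) (t i.2)) ^ (1 - b)) ^ (1 / (1 - b))
      = powTrace (-g⁻¹) T := by
    rw [hT.1.powTrace_eq, Fintype.sum_prod_type_right]
    refine Finset.sum_congr rfl fun j _ ↦ ?_
    trans (∑ i, w i j) * supportPow (-g⁻¹) (t j)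
    swap
    · rw [hw2, one_mul]
    rw [Finset.sum_mul]
    refine Finset.sum_congr rfl fun i _ ↦ ?_
    rw [← Real.rpow_mul (mul_nonneg (hw _ _) (supportPow_nonneg _ (ht _))),
      mul_one_div_cancel hb2.ne', Real.rpow_one]
  rw [e1, e2, e3] at h
  have hXT := hX.trace_mul_nonneg hT
  have hT0 := hT.powTrace_nonneg (-g⁻¹)
  calc powTrace b X ^ (1 / b)
      ≤ ((X * T).trace.re ^ (1 / (1 / b)) * powTrace (-g⁻¹) T ^ (1 / (1 / (1 - b)))) ^ (1 / b) :=
        Real.rpow_le_rpow (hX.powTrace_nonneg b) h (by positivity)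
    _ = (X * T).trace.re * powTrace (-g⁻¹) T ^ g := by
        rw [Real.mul_rpow (by positivity) (by positivity), ← Real.rpow_mul hXT, ← Real.rpow_mul hT0,
          one_div_one_div, one_div_one_div, mul_one_div_cancel hb0.ne', Real.rpow_one, ← hg,
          mul_one_div, mul_div_cancel_left₀ _ hb0.ne']

section Legs

variable {A B C : Type*} [Fintype A] [DecidableEq A] [Fintype B] [DecidableEq B]
  [Fintype C] [DecidableEq C]

/-- Exchange the last two legs of a tensor with three legs. -/
def swapLegs (Φ : Matrix (A × B) C ℂ) : Matrix (A × C) B ℂ := of fun x b ↦ Φ (x.1, b) x.2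

/-- The map `S ↦ Φᴴ (1 ⊗ S) Φ` associated to a tensor with three legs. -/
noncomputable def legMap (Φ : Matrix (A × B) C ℂ) (S : Matrix B B ℂ) : Matrix C C ℂ :=
  Φᴴ * ((1 : Matrix A A ℂ) ⊗ₖ S) * Φ

omit [Fintype A] [DecidableEq A] [Fintype B] [DecidableEq B] [Fintype C] [DecidableEq C] in
@[simp] lemma swapLegs_swapLegs (Φ : Matrix (A × B) C ℂ) : swapLegs (swapLegs Φ) = Φ := rfl

omit [DecidableEq B] [Fintype C] [DecidableEq C] in
lemma legMap_apply (Φ : Matrix (A × B) C ℂ) (S : Matrix B B ℂ) (c c' : C) :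
    legMap Φ S c c' = ∑ a, ∑ b', ∑ b, star (Φ (a, b) c) * S b b' * Φ (a, b') c' := by
  simp only [legMap, mul_apply, conjTranspose_apply, Fintype.sum_prod_type, kroneckerMap_apply,
    one_apply, Finset.sum_mul]
  refine Finset.sum_congr rfl fun a _ ↦ Finset.sum_congr rfl fun b _ ↦ ?_
  rw [Finset.sum_eq_single a]
  · simp
  · intro a' _ h
    simp [h]
  · simp

omit [DecidableEq B] [DecidableEq C] in
/-- The maps associated to a tensor and to the tensor with exchanged legs are dual. -/
lemma trace_legMap_mul (Φ : Matrix (A × B) C ℂ) (S : Matrix B B ℂ) (T : Matrix C C ℂ) :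
    (legMap Φ S * T).trace = (legMap (swapLegs Φ) Tᵀ * Sᵀ).trace := by
  simp only [trace, diag_apply, mul_apply, legMap_apply, transpose_apply, swapLegs, of_apply,
    Finset.sum_mul]
  simp_rw [← Fintype.sum_prod_type']
  refine Fintype.sum_equiv
    ⟨fun p ↦ (p.2.2.2.2, p.2.2.2.1, p.2.2.1, p.2.1, p.1),
      fun p ↦ (p.2.2.2.2, p.2.2.2.1, p.2.2.1, p.2.1, p.1), fun _ ↦ rfl, fun _ ↦ rfl⟩ _ _ fun p ↦ ?_
  simp only [Equiv.coe_fn_mk]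
  ring

omit [DecidableEq B] [DecidableEq C] in
lemma PosSemidef.legMap (Φ : Matrix (A × B) C ℂ) {S : Matrix B B ℂ} (hS : S.PosSemidef) :
    (legMap Φ S).PosSemidef :=
  (PosSemidef.one.kronecker hS).conjTranspose_mul_mul_same Φ

omit [DecidableEq B] [Fintype C] [DecidableEq C] in
lemma continuous_legMap (Φ : Matrix (A × B) C ℂ) : Continuous (Matrix.legMap Φ) := by
  refine continuous_matrix fun i j ↦ ?_
  simp only [legMap_apply]
  fun_prop

/-- The sandwiched operator has the same spectrum as the image of the marginal power. -/
lemma powTrace_sandwich (Φ : Matrix (A × B) C ℂ) {σ : Matrix B B ℂ} (hσ : σ.PosSemidef)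
    (α s : ℝ) :
    powTrace α (matPow ((1 : Matrix A A ℂ) ⊗ₖ σ) s * (Φ * Φᴴ) * matPow ((1 : Matrix A A ℂ) ⊗ₖ σ) s)
      = powTrace α (legMap Φ (matPow σ (s + s))) := by
  rw [matPow_one_kronecker hσ.1]
  set K := (1 : Matrix A A ℂ) ⊗ₖ matPow σ s with hK
  have hKh : Kᴴ = K := (hσ.matPow s).1.one_kronecker
  have h1 : K * (Φ * Φᴴ) * K = (K * Φ) * (K * Φ)ᴴ := by
    rw [conjTranspose_mul, hKh]
    simp only [Matrix.mul_assoc]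
  rw [h1, powTrace_mul_conjTranspose, conjTranspose_mul, hKh, legMap, ← hσ.matPow_mul_matPow,
    ← one_mul (1 : Matrix A A ℂ), mul_kronecker_mul, ← hK]
  simp only [Matrix.mul_assoc]

lemma coe_eq_neg_Dtilde_iff (Φ : Matrix (A × B) C ℂ) (hΦ : (Φ * Φᴴ).trace = 1)
    {σ : Matrix B B ℂ} (hσ : σ.PosSemidef) {α : ℝ} (hα : α ≠ 0) (x : ℝ) :
    (x : EReal) = - Dtilde α (Φ * Φᴴ) ((1 : Matrix A A ℂ) ⊗ₖ σ) ↔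
      (((Φ * Φᴴ) * ((1 : Matrix A A ℂ) ⊗ₖ σ)).trace ≠ 0 ∧
        (dominates ((1 : Matrix A A ℂ) ⊗ₖ σ) (Φ * Φᴴ) ∨ α < 1)) ∧
      x = -((α - 1)⁻¹ * Real.logb 2 (powTrace α (legMap Φ (matPow σ ((1 - α) / α))))) := by
  have h : (1 - α) / (2 * α) + (1 - α) / (2 * α) = (1 - α) / α := by field_simp; ring
  rw [Dtilde, ← h, ← powTrace_sandwich Φ hσ, powTrace]
  split_ifs with hc
  · rw [hΦ, Complex.one_re, div_one, ← EReal.coe_neg, EReal.coe_eq_coe_iff]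
    simp [hc]
  · simp [hc]

end Legs

lemma powTrace_zero (t : ℝ) : powTrace t (0 : Matrix n n ℂ) = 0 := by
  have h : (0 : Matrix n n ℂ).IsHermitian := isHermitian_zero
  rw [h.powTrace_eq, h.eigenvalues_eq_zero_iff.mpr rfl]
  simp

/-- The Schatten norm of a positive semidefinite matrix is attained on the dual unit ball. -/
lemma PosSemidef.exists_trace_mul_eq {N : Matrix n n ℂ} (hN : N.PosSemidef) {a p : ℝ}
    (hap : a.HolderConjugate p) :
    ∃ T : Matrix n n ℂ, T.PosSemidef ∧ powTrace p T ≤ 1 ∧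
      (N * T).trace.re = powTrace a N ^ (1 / a) := by
  have ha0 := hap.ne_zero
  have hp0 := hap.symm.ne_zero
  rcases eq_or_ne N 0 with rfl | h0
  · refine ⟨0, PosSemidef.zero, by simp [powTrace_zero], ?_⟩
    simp [powTrace_zero, Real.zero_rpow (inv_ne_zero ha0)]
  have hx := hN.eigenvalues_nonneg
  have hZ := hN.powTrace_pos a h0
  have hsum : ∑ i, hN.1.eigenvalues i ^ a = powTrace a N := by
    rw [hN.1.powTrace_eq]
    simp_rw [supportPow_eq_rpow ha0]
  set Z := powTrace a N
  refine ⟨cfc (fun x ↦ Z ^ (-(1 / p)) * x ^ (a - 1)) N, hN.1.posSemidef_cfc _ fun i ↦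
    mul_nonneg (by positivity) (Real.rpow_nonneg (hx i) _), ?_, ?_⟩
  · rw [hN.1.powTrace_cfc]
    refine le_of_eq ?_
    calc _ = ∑ i, Z⁻¹ * hN.1.eigenvalues i ^ a := by
          refine Finset.sum_congr rfl fun i _ ↦ ?_
          rw [supportPow_eq_rpow hp0, Real.mul_rpow (by positivity) (Real.rpow_nonneg (hx i) _),
            ← Real.rpow_mul hZ.le, ← Real.rpow_mul (hx i), neg_mul, one_div_mul_cancel hp0,
            Real.rpow_neg_one, hap.sub_one_mul_conj]
      _ = 1 := by rw [← Finset.mul_sum, hsum, inv_mul_cancel₀ hZ.ne']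
  · conv_lhs =>
      enter [1, 1, 1]
      rw [← hN.1.cfc_id_fun]
    rw [hN.1.cfc_mul_cfc, hN.1.trace_cfc, Complex.ofReal_re]
    calc _ = ∑ i, Z ^ (-(1 / p)) * hN.1.eigenvalues i ^ a := by
          refine Finset.sum_congr rfl fun i _ ↦ ?_
          have : hN.1.eigenvalues i ^ a = hN.1.eigenvalues i * hN.1.eigenvalues i ^ (a - 1) := by
            rw [← Real.rpow_one_add' (hx i)] <;> simp [ha0]
          rw [this]
          ring
      _ = Z ^ (-(1 / p) + 1) := by
          rw [← Finset.mul_sum, hsum, Real.rpow_add hZ, Real.rpow_one]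
      _ = _ := by
          congr 1
          have := hap.inv_add_inv_eq_one
          rw [one_div, one_div]
          linarith

/-- The reverse Hölder inequality is approximately saturated. -/
lemma PosSemidef.exists_trace_mul_inv_lt {K : Matrix n n ℂ} (hK : K.PosSemidef) {b g V : ℝ}
    (hb0 : 0 < b) (hg0 : 0 < g) (hg : b * g = 1 - b) (hV : powTrace b K ^ (1 / b) < V) :
    ∃ S : Matrix n n ℂ, S.PosDef ∧ powTrace g⁻¹ S ≤ 1 ∧ (K * S⁻¹).trace.re < V := by
  have hx := hK.eigenvalues_nonneg
  have hsum : ∑ i, hK.1.eigenvalues i ^ b = powTrace b K := by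
    rw [hK.1.powTrace_eq]
    simp_rw [supportPow_eq_rpow hb0.ne']
  have hZ := hK.powTrace_nonneg b
  set x := hK.1.eigenvalues
  set Z := powTrace b K
  set d : ℝ := (Fintype.card n : ℝ)
  obtain ⟨ε, hεV, hε⟩ : ∃ ε : ℝ, (Z + d * ε) ^ g * Z < V ∧ 0 < ε := by
    have hcont : Continuous fun ε : ℝ ↦ (Z + d * ε) ^ g * Z := by fun_prop (disch := linarith)
    have h0 : (Z + d * 0) ^ g * Z < V := by
      have : 1 / b = g + 1 := by field_simp; linarith
      rwa [mul_zero, add_zero, ← Real.rpow_add_one' hZ (by positivity), ← this]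
    have h1 := (hcont.tendsto 0).eventually_lt_const h0
    exact ((h1.filter_mono nhdsWithin_le_nhds).and (self_mem_nhdsWithin (s := Set.Ioi 0))).exists
  have hpos : ∀ i, 0 < (x i ^ b + ε) / (Z + d * ε) := fun i ↦ by
    have : 0 < d := by
      have : Nonempty n := ⟨i⟩
      exact Nat.cast_pos.mpr Fintype.card_pos
    have := Real.rpow_nonneg (hx i) b
    positivity
  set h : ℝ → ℝ := fun y ↦ ((y ^ b + ε) / (Z + d * ε)) ^ g with hh
  have hhpos : ∀ i, 0 < h (x i) := fun i ↦ Real.rpow_pos_of_pos (hpos i) g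
  have hSinv : cfc h K * cfc (fun y ↦ (h y)⁻¹) K = 1 := by
    rw [hK.1.cfc_mul_cfc, ← hK.1.cfc_one_fun]
    exact hK.1.cfc_congr_eigenvalues fun i ↦ mul_inv_cancel₀ (hhpos i).ne'
  refine ⟨cfc h K, ?_, ?_, ?_⟩
  · exact (hK.1.posSemidef_cfc h fun i ↦ (hhpos i).le).posDef_iff_isUnit.mpr
      (IsUnit.of_mul_eq_one _ hSinv)
  · rw [hK.1.powTrace_cfc]
    calc _ = ∑ i, (x i ^ b + ε) / (Z + d * ε) := by
          refine Finset.sum_congr rfl fun i _ ↦ ?_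
          rw [supportPow_eq_rpow (inv_ne_zero hg0.ne'), ← Real.rpow_mul (hpos i).le,
            mul_inv_cancel₀ hg0.ne', Real.rpow_one]
      _ = (Z + d * ε) / (Z + d * ε) := by
          rw [← Finset.sum_div, Finset.sum_add_distrib, hsum]
          simp [d]
      _ ≤ 1 := div_self_le_one _
  · rw [Matrix.inv_eq_right_inv hSinv]
    conv_lhs =>
      enter [1, 1, 1]
      rw [← hK.1.cfc_id_fun]
    rw [hK.1.cfc_mul_cfc, hK.1.trace_cfc, Complex.ofReal_re]
    refine lt_of_le_of_lt ?_ hεV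
    rw [← hsum, Finset.mul_sum, hsum]
    refine Finset.sum_le_sum fun i _ ↦ ?_
    change x i * (h (x i))⁻¹ ≤ _
    have hZd : 0 ≤ Z + d * ε := by positivity
    rcases (hx i).eq_or_lt' with h0 | h0
    · simp only [x, h0, zero_mul]
      positivity
    · have hxb := Real.rpow_pos_of_pos h0 b
      change 0 < x i at h0
      rw [hh]
      dsimp only
      rw [Real.div_rpow (by positivity) hZd, inv_div, mul_div_assoc', mul_comm (x i), mul_div_assoc]
      refine mul_le_mul_of_nonneg_left ?_ (by positivity)
      rw [div_le_iff₀ (by positivity)]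
      calc x i = x i ^ b * (x i ^ b) ^ g := by
            rw [← Real.rpow_mul h0.le, ← Real.rpow_add h0, hg]
            simp
        _ ≤ _ := by gcongr; linarith

section Legs

variable {A B C : Type*} [Fintype A] [DecidableEq A] [Fintype B] [DecidableEq B]
  [Fintype C] [DecidableEq C]

omit [Fintype C] [DecidableEq C] in
lemma legMap_matPow_eq_zero {Φ : Matrix (A × B) C ℂ} {σ : Matrix B B ℂ} (hσ : σ.PosSemidef)
    {s : ℝ} (h : legMap Φ (matPow σ s) = 0) (t : ℝ) : legMap Φ (matPow σ t) = 0 := by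
  have hhalf : ((1 : Matrix A A ℂ) ⊗ₖ matPow σ (s / 2)) * Φ = 0 := by
    rw [← conjTranspose_mul_self_eq_zero, conjTranspose_mul, (hσ.matPow _).1.one_kronecker,
      Matrix.mul_assoc, ← Matrix.mul_assoc _ _ Φ, ← mul_kronecker_mul, one_mul,
      hσ.matPow_mul_matPow, add_halves, ← Matrix.mul_assoc]
    exact h
  have hsplit : (1 : Matrix A A ℂ) ⊗ₖ matPow σ t =
      ((1 : Matrix A A ℂ) ⊗ₖ matPow σ (t - s / 2)) * ((1 : Matrix A A ℂ) ⊗ₖ matPow σ (s / 2)) := by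
    rw [← mul_kronecker_mul, one_mul, hσ.matPow_mul_matPow, sub_add_cancel]
  rw [legMap, hsplit, Matrix.mul_assoc, Matrix.mul_assoc, hhalf, Matrix.mul_zero, Matrix.mul_zero]

lemma trace_mul_one_kronecker_ne_zero_iff {Φ : Matrix (A × B) C ℂ} {σ : Matrix B B ℂ}
    (hσ : σ.PosSemidef) (s t : ℝ) :
    ((Φ * Φᴴ) * ((1 : Matrix A A ℂ) ⊗ₖ σ)).trace ≠ 0 ↔
      0 < powTrace t (legMap Φ (matPow σ s)) := by
  have h1 : ((Φ * Φᴴ) * ((1 : Matrix A A ℂ) ⊗ₖ σ)).trace = (legMap Φ (matPow σ 1)).trace := by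
    rw [hσ.matPow_one, legMap, Matrix.mul_assoc, trace_mul_comm]
  rw [h1, Ne, (PosSemidef.legMap Φ (hσ.matPow 1)).trace_eq_zero_iff]
  constructor
  · intro h
    exact (PosSemidef.legMap Φ (hσ.matPow s)).powTrace_pos t
      fun h0 ↦ h (legMap_matPow_eq_zero hσ h0 1)
  · intro h h0
    rw [legMap_matPow_eq_zero hσ h0 s, powTrace_zero] at h
    exact h.false

omit [DecidableEq C] in
lemma dominates_transpose_matPow_legMap {Φ : Matrix (A × B) C ℂ} {σ : Matrix B B ℂ}
    (hσ : σ.PosSemidef) (hdom : dominates ((1 : Matrix A A ℂ) ⊗ₖ σ) (Φ * Φᴴ)) (t : ℝ)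
    (R : Matrix C C ℂ) : dominates (matPow σ t)ᵀ (legMap (swapLegs Φ) R) := by
  intro v hv
  have h1 : σᵀ *ᵥ v = 0 := by
    have : σ = matPow σ t * matPow σ (1 - t) := by
      rw [hσ.matPow_mul_matPow, add_sub_cancel, hσ.matPow_one]
    rw [this, transpose_mul, ← mulVec_mulVec, hv, mulVec_zero]
  have h2 : σ *ᵥ star v = 0 := by
    have := congrArg star h1
    rwa [star_mulVec, star_zero, ← mulVec_transpose, hσ.transpose.1,
      transpose_transpose] at this
  have h3 : swapLegs Φ *ᵥ v = 0 := by
    ext ⟨a, c⟩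
    have h4 : ((1 : Matrix A A ℂ) ⊗ₖ σ) *ᵥ (fun x ↦ if a = x.1 then star v x.2 else 0) = 0 := by
      ext ⟨a', b'⟩
      have := congrFun h2 b'
      simp only [mulVec, dotProduct, kroneckerMap_apply, Fintype.sum_prod_type, one_apply] at this ⊢
      simp only [mul_ite, mul_zero, Finset.sum_ite_irrel, Finset.sum_const_zero,
        Finset.sum_ite_eq, Finset.mem_univ, if_true]
      split_ifs with h
      · simpa using this
      · simp
    have h5 := (self_mul_conjTranspose_mulVec_eq_zero _ _).mp (hdom _ h4)
    have h6 := congrArg star (congrFun h5 c)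
    simp only [mulVec, dotProduct, Fintype.sum_prod_type, mul_ite, mul_zero,
      Finset.sum_ite_irrel, Finset.sum_const_zero, Finset.sum_ite_eq, Finset.mem_univ, if_true,
      conjTranspose_apply, Pi.star_apply, Pi.zero_apply, star_zero, star_sum, star_mul,
      star_star] at h6
    simp only [mulVec, dotProduct, swapLegs, of_apply, Pi.zero_apply]
    rw [← h6]
    exact Finset.sum_congr rfl fun _ _ ↦ mul_comm _ _
  rw [legMap, ← mulVec_mulVec, h3, mulVec_zero]

/-- Weak duality between the two optimisation problems. -/
lemma powTrace_swapLegs_le {Φ : Matrix (A × B) C ℂ} {σ : Matrix B B ℂ} {τ : Matrix C C ℂ}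
    (hσ : σ.PosSemidef) (hdom : dominates ((1 : Matrix A A ℂ) ⊗ₖ σ) (Φ * Φᴴ))
    (hσ1 : σ.trace.re ≤ 1) (hτ : τ.PosSemidef) (hτ1 : τ.trace.re ≤ 1) {a b g : ℝ}
    (ha : a.HolderConjugate g⁻¹) (hb0 : 0 < b) (hb1 : b < 1) (hg : b * g = 1 - b) :
    powTrace b (legMap (swapLegs Φ) (matPow τ g)) ^ (1 / b) ≤
      powTrace a (legMap Φ (matPow σ (-g))) ^ (1 / a) := by
  have hg0 : 0 < g := inv_pos.mp ha.symm.pos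
  have hq := (PosSemidef.legMap (swapLegs Φ) (hτ.matPow g)).powTrace_rpow_le_trace_mul
    (hσ.matPow (-g)).transpose (dominates_transpose_matPow_legMap hσ hdom _ _) hb0 hb1 hg
  have hp := (PosSemidef.legMap Φ (hσ.matPow (-g))).trace_mul_le (hτ.matPow g).transpose ha
  have hP := (PosSemidef.legMap Φ (hσ.matPow (-g))).powTrace_nonneg a
  rw [trace_legMap_mul, transpose_transpose, powTrace_transpose (hτ.matPow g).1,
    hτ.powTrace_matPow, mul_inv_cancel₀ hg0.ne', hτ.powTrace_one] at hp
  rw [powTrace_transpose (hσ.matPow _).1, hσ.powTrace_matPow, neg_mul_neg,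
    mul_inv_cancel₀ hg0.ne', hσ.powTrace_one] at hq
  have hσ0 : 0 ≤ σ.trace.re := by rw [← hσ.powTrace_one]; exact hσ.powTrace_nonneg 1
  have hτ0 : 0 ≤ τ.trace.re := by rw [← hτ.powTrace_one]; exact hτ.powTrace_nonneg 1
  have h1 : σ.trace.re ^ g ≤ 1 := Real.rpow_le_one hσ0 hσ1 hg0.le
  have h2 : τ.trace.re ^ (1 / g⁻¹) ≤ 1 := Real.rpow_le_one hτ0 hτ1 (by positivity)
  refine (hq.trans ?_).trans (hp.trans (mul_le_of_le_one_right (by positivity) h2))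
  refine mul_le_of_le_one_right ?_ h1
  exact (PosSemidef.legMap _ (hτ.matPow g)).trace_mul_nonneg (hσ.matPow (-g)).transpose

end Legs

/-- The positive semidefinite part of the dual unit ball of the Schatten norm of order `a`. -/
def dualBall (n : Type*) [Fintype n] [DecidableEq n] (a : ℝ) : Set (Matrix n n ℂ) :=
  {T | T.PosSemidef ∧ ∀ X : Matrix n n ℂ, X.PosSemidef → (X * T).trace.re ≤ powTrace a X ^ (1 / a)}

lemma PosSemidef.mem_dualBall_iff {T : Matrix n n ℂ} (hT : T.PosSemidef) {a p : ℝ}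
    (hap : a.HolderConjugate p) : T ∈ dualBall n a ↔ powTrace p T ≤ 1 := by
  have hp := hap.symm.pos
  have ha := hap.pos
  have hT0 := hT.powTrace_nonneg p
  constructor
  · rintro ⟨-, h⟩
    obtain ⟨X, hX, hX1, hXT⟩ := hT.exists_trace_mul_eq hap.symm
    have h1 := h X hX
    rw [trace_mul_comm, hXT] at h1
    have h2 := h1.trans (Real.rpow_le_one (hX.powTrace_nonneg a) hX1 (by positivity))
    by_contra! h3
    exact absurd (Real.one_lt_rpow h3 (by positivity : 0 < 1 / p)) h2.not_gt
  · refine fun h ↦ ⟨hT, fun X hX ↦ (hX.trace_mul_le hT hap).trans ?_⟩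
    have := hX.powTrace_nonneg a
    exact mul_le_of_le_one_right (by positivity) (Real.rpow_le_one hT0 h (by positivity))

omit [Fintype n] [DecidableEq n] in
lemma convex_posSemidef : Convex ℝ {T : Matrix n n ℂ | T.PosSemidef} :=
  fun _ hS _ hT _ _ ha hb _ ↦ (hS.smul ha).add (hT.smul hb)

omit [Fintype n] [DecidableEq n] in
lemma convex_posDef : Convex ℝ {T : Matrix n n ℂ | T.PosDef} :=
  convex_iff_forall_pos.mpr fun _ hS _ hT _ _ ha hb _ ↦ (hS.smul ha).add (hT.smul hb)

omit [DecidableEq n] in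
lemma isClosed_posSemidef : IsClosed {T : Matrix n n ℂ | T.PosSemidef} := by
  simp only [posSemidef_iff_dotProduct_mulVec, IsHermitian, Set.ofPred_and, Set.ofPred_forall]
  refine (isClosed_eq (by fun_prop) (by fun_prop)).inter (isClosed_iInter fun x ↦ ?_)
  exact isClosed_le continuous_const (by fun_prop)

lemma convex_dualBall (a : ℝ) : Convex ℝ (dualBall n a) := by
  refine convex_posSemidef.inter fun S hS T hT s t hs ht hst X hX ↦ ?_
  have h1 := mul_le_mul_of_nonneg_left (hS X hX) hs
  have h2 := mul_le_mul_of_nonneg_left (hT X hX) ht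
  rw [Matrix.mul_add, Matrix.mul_smul, Matrix.mul_smul, trace_add, trace_smul, trace_smul,
    Complex.add_re, Complex.smul_re, Complex.smul_re, smul_eq_mul, smul_eq_mul]
  linear_combination h1 + h2 + hst * powTrace a X ^ (1 / a)

lemma PosSemidef.norm_apply_le {T : Matrix n n ℂ} (hT : T.PosSemidef) (i j : n) :
    ‖T i j‖ ≤ T.trace.re := by
  obtain ⟨B, rfl⟩ : ∃ B : Matrix n n ℂ, T = Bᴴ * B := by
    refine ⟨_root_.matPow T (1 / 2), ?_⟩
    rw [(hT.matPow _).1, hT.matPow_mul_matPow, add_halves, hT.matPow_one]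
  have hdiag : ∀ l, ((Bᴴ * B) l l).re = ∑ k, ‖B k l‖ ^ 2 := fun l ↦ by
    simp only [mul_apply, conjTranspose_apply, Complex.star_def, ← Complex.normSq_eq_conj_mul_self,
      Complex.re_sum, Complex.ofReal_re, Complex.normSq_eq_norm_sq]
  have hle : ∀ l, ((Bᴴ * B) l l).re ≤ (Bᴴ * B).trace.re := fun l ↦ by
    rw [trace, Complex.re_sum]
    exact Finset.single_le_sum (f := fun l ↦ ((Bᴴ * B) l l).re)
      (fun l _ ↦ by rw [hdiag]; positivity) (Finset.mem_univ l)
  calc ‖(Bᴴ * B) i j‖ ≤ ∑ k, ‖B k i‖ * ‖B k j‖ := by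
        rw [mul_apply]
        refine (norm_sum_le _ _).trans (le_of_eq ?_)
        simp
    _ ≤ ∑ k, (‖B k i‖ ^ 2 / 2 + ‖B k j‖ ^ 2 / 2) := by
        refine Finset.sum_le_sum fun k _ ↦ ?_
        linarith [two_mul_le_add_sq ‖B k i‖ ‖B k j‖]
    _ = ((Bᴴ * B) i i).re / 2 + ((Bᴴ * B) j j).re / 2 := by
        rw [hdiag, hdiag, Finset.sum_add_distrib, Finset.sum_div, Finset.sum_div]
    _ ≤ _ := by linarith [hle i, hle j]

lemma isCompact_dualBall (a : ℝ) : IsCompact (dualBall n a) := by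
  have hclosed : IsClosed (dualBall n a) := by
    have : dualBall n a = {T | T.PosSemidef} ∩ ⋂ X : Matrix n n ℂ, ⋂ _ : X.PosSemidef,
        {T | (X * T).trace.re ≤ powTrace a X ^ (1 / a)} := by
      ext T
      simp [dualBall]
    rw [this]
    refine isClosed_posSemidef.inter
      (isClosed_iInter fun X ↦ isClosed_iInter fun hX ↦ isClosed_le ?_ continuous_const)
    exact Complex.continuous_re.comp (by fun_prop)
  set r := powTrace a (1 : Matrix n n ℂ) ^ (1 / a)
  have hsub : dualBall n a ⊆ Set.univ.pi fun _ ↦ Set.univ.pi fun _ ↦ Metric.closedBall (0 : ℂ) r := by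
    intro T hT i _ j _
    have := hT.2 1 PosSemidef.one
    rw [Matrix.one_mul] at this
    rw [mem_closedBall_zero_iff]
    exact (hT.1.norm_apply_le i j).trans this
  exact (isCompact_univ_pi fun _ ↦ isCompact_univ_pi fun _ ↦
    isCompact_closedBall (0 : ℂ) r).of_isClosed_subset hclosed hsub

/-- For `K ≥ 0` the function `S ↦ Tr (K S⁻¹)` is convex on positive definite matrices. -/
lemma PosSemidef.convexOn_trace_mul_inv {K : Matrix n n ℂ} (hK : K.PosSemidef) :
    ConvexOn ℝ {S : Matrix n n ℂ | S.PosDef} fun S ↦ (K * S⁻¹).trace.re := by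
  have key : ∀ S W : Matrix n n ℂ, S.PosDef → W.IsHermitian →
      2 * (K * W).trace.re - (K * (W * S * W)).trace.re ≤ (K * S⁻¹).trace.re := by
    intro S W hS hW
    have hu : IsUnit S.det := S.isUnit_iff_isUnit_det.mp hS.isUnit
    have hD : (S⁻¹ - W)ᴴ = S⁻¹ - W := hS.1.inv.sub hW
    have h := hK.trace_mul_nonneg (hS.posSemidef.conjTranspose_mul_mul_same (S⁻¹ - W))
    have : (S⁻¹ - W)ᴴ * S * (S⁻¹ - W) = S⁻¹ - W - W + W * S * W := by
      rw [hD]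
      simp only [Matrix.sub_mul, Matrix.mul_sub, nonsing_inv_mul S hu, Matrix.one_mul]
      rw [Matrix.mul_assoc W S S⁻¹, mul_nonsing_inv S hu, Matrix.mul_one]
      abel
    rw [this] at h
    simp only [Matrix.mul_add, Matrix.mul_sub, trace_add, trace_sub, Complex.add_re,
      Complex.sub_re] at h
    linarith
  refine ⟨convex_posDef, fun S hS T hT a b ha hb hab ↦ ?_⟩
  have hR := convex_posDef hS hT ha hb hab
  set R := a • S + b • T with hRdef
  have hu : IsUnit R.det := R.isUnit_iff_isUnit_det.mp hR.isUnit
  have h1 := mul_le_mul_of_nonneg_left (key S R⁻¹ hS hR.1.inv) ha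
  have h2 := mul_le_mul_of_nonneg_left (key T R⁻¹ hT hR.1.inv) hb
  have h3 : a * (K * (R⁻¹ * S * R⁻¹)).trace.re + b * (K * (R⁻¹ * T * R⁻¹)).trace.re =
      (K * R⁻¹).trace.re := by
    have : R⁻¹ = a • (R⁻¹ * S * R⁻¹) + b • (R⁻¹ * T * R⁻¹) := by
      have h : R⁻¹ * R * R⁻¹ = R⁻¹ := by rw [nonsing_inv_mul R hu, Matrix.one_mul]
      conv_lhs => rw [← h, hRdef]
      rw [← hRdef, Matrix.mul_add, Matrix.add_mul, Matrix.mul_smul, Matrix.mul_smul,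
        Matrix.smul_mul, Matrix.smul_mul]
    conv_rhs => rw [this]
    rw [Matrix.mul_add, Matrix.mul_smul, Matrix.mul_smul, trace_add, trace_smul, trace_smul,
      Complex.add_re, Complex.smul_re, Complex.smul_re, smul_eq_mul, smul_eq_mul]
  simp only [smul_eq_mul]
  linear_combination h1 + h2 + h3 - 2 * hab * (K * R⁻¹).trace.re

section Legs

variable {A B C : Type*} [Fintype A] [DecidableEq A] [Fintype B] [DecidableEq B]
  [Fintype C] [DecidableEq C]

lemma exists_posDef_forall_trace_lt (Φ : Matrix (A × B) C ℂ) {a b g V : ℝ}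
    (ha : a.HolderConjugate g⁻¹) (hb0 : 0 < b) (hg : b * g = 1 - b)
    (hV : ∀ T ∈ dualBall C a, powTrace b (legMap (swapLegs Φ) Tᵀ) ^ (1 / b) < V) :
    ∃ S ∈ dualBall B a ∩ {S | S.PosDef}, ∀ T ∈ dualBall C a, (legMap Φ S⁻¹ * T).trace.re < V := by
  have hg0 : 0 < g := inv_pos.mp ha.symm.pos
  set f : Matrix C C ℂ → Matrix B B ℂ → ℝ := fun T S ↦ -(legMap Φ S⁻¹ * T).trace.re with hf
  set Y : Set (Matrix B B ℂ) := dualBall B a ∩ {S | S.PosDef} with hY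
  have hK : ∀ T ∈ dualBall C a, (legMap (swapLegs Φ) Tᵀ)ᵀ.PosSemidef := fun T hT ↦
    (PosSemidef.legMap _ hT.1.transpose).transpose
  have hfS : ∀ T S, f T S = -((legMap (swapLegs Φ) Tᵀ)ᵀ * S⁻¹).trace.re := fun T S ↦ by
    rw [hf]
    dsimp only
    rw [trace_legMap_mul, ← trace_transpose, transpose_mul, transpose_transpose, trace_mul_comm]
  have hexists : ∀ T ∈ dualBall C a, ∃ S ∈ Y, -V < f T S := by
    intro T hT
    have h := hV T hT
    rw [← powTrace_transpose (PosSemidef.legMap _ hT.1.transpose).1] at h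
    obtain ⟨S, hS, hS1, hST⟩ := (hK T hT).exists_trace_mul_inv_lt hb0 hg0 hg h
    refine ⟨S, ⟨(hS.posSemidef.mem_dualBall_iff ha).mpr hS1, hS⟩, ?_⟩
    rw [hfS]
    linarith
  have hne : (dualBall C a).Nonempty :=
    ⟨0, (PosSemidef.zero.mem_dualBall_iff ha).mpr (by simp [powTrace_zero])⟩
  have hcY : Convex ℝ Y := (convex_dualBall a).inter convex_posDef
  have hlsc : ∀ S ∈ Y, LowerSemicontinuousOn (fun T ↦ f T S) (dualBall C a) := fun S _ ↦ by
    refine Continuous.lowerSemicontinuous ?_ |>.lowerSemicontinuousOn _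
    exact (Complex.continuous_re.comp (by fun_prop)).neg
  have hqc : ∀ S ∈ Y, QuasiconvexOn ℝ (dualBall C a) fun T ↦ f T S := fun S _ ↦ by
    refine ConvexOn.quasiconvexOn ⟨convex_dualBall a, fun T _ R _ s t _ _ _ ↦ le_of_eq ?_⟩
    simp only [hf, Matrix.mul_add, Matrix.mul_smul, trace_add, trace_smul, Complex.add_re,
      Complex.smul_re, smul_eq_mul]
    ring
  have husc : ∀ T ∈ dualBall C a, UpperSemicontinuousOn (f T) Y := fun T _ ↦ by
    refine ContinuousOn.upperSemicontinuousOn fun S hS ↦ ContinuousAt.continuousWithinAt ?_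
    have hinv : ContinuousAt (fun S : Matrix B B ℂ ↦ S⁻¹) S := by
      refine continuousAt_matrix_inv S ?_
      have hu : S.det ≠ 0 := (S.isUnit_iff_isUnit_det.mp hS.2.isUnit).ne_zero
      rw [show (Ring.inverse : ℂ → ℂ) = Inv.inv from funext Ring.inverse_eq_inv]
      exact continuousAt_inv₀ hu
    have h2 : Continuous fun R : Matrix B B ℂ ↦ -(legMap Φ R * T).trace.re :=
      (Complex.continuous_re.comp
        (((continuous_legMap Φ).matrix_mul continuous_const).matrix_trace)).neg
    exact h2.continuousAt.comp hinv
  have hqv : ∀ T ∈ dualBall C a, QuasiconcaveOn ℝ Y (f T) := fun T hT ↦ by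
    refine ConcaveOn.quasiconcaveOn ?_
    rw [show f T = -fun S ↦ ((legMap (swapLegs Φ) Tᵀ)ᵀ * S⁻¹).trace.re from funext (hfS T)]
    exact ((hK T hT).convexOn_trace_mul_inv.subset Set.inter_subset_right hcY).neg
  obtain ⟨u, hu⟩ :=
    (LowerSemicontinuousOn.inter_biInter_preimage_Iic_eq_empty_iff_exists_finset (c := -V)
      (isCompact_dualBall a) hlsc).mp (by
        refine Set.eq_empty_of_forall_notMem fun T hT ↦ ?_
        obtain ⟨S, hS, hST⟩ := hexists T hT.1
        exact absurd (Set.mem_iInter₂.mp hT.2 S hS) (not_le.mpr hST))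
  obtain ⟨S, hS, h⟩ := Sion.exists_lt_iInf_of_lt_iInf_of_finite hne (isCompact_dualBall a) hlsc hqc
    hcY husc hqv (convex_dualBall a) (t := -V) (Set.toFinite _)
    (Subtype.coe_image_subset Y ↑u) (fun T hT ↦ by
      obtain ⟨S, hS, hST⟩ := hu T hT
      exact ⟨S, ⟨S, hS, rfl⟩, hST⟩)
  exact ⟨S, hS, fun T hT ↦ neg_lt_neg_iff.mp (h T hT)⟩

/-- Strong duality between the two optimisation problems. -/
lemma exists_posDef_powTrace_le (Φ : Matrix (A × B) C ℂ) {a b g V : ℝ}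
    (ha : a.HolderConjugate g⁻¹) (hb0 : 0 < b) (hg : b * g = 1 - b)
    (hV : ∀ τ : Matrix C C ℂ, τ.PosSemidef → τ.trace.re ≤ 1 →
      powTrace b (legMap (swapLegs Φ) (matPow τ g)) ^ (1 / b) < V) :
    ∃ σ : Matrix B B ℂ, σ.PosDef ∧ σ.trace.re ≤ 1 ∧
      powTrace a (legMap Φ (matPow σ (-g))) ^ (1 / a) ≤ V := by
  have hg0 : 0 < g := inv_pos.mp ha.symm.pos
  obtain ⟨S, ⟨hS1, hS⟩, h⟩ := exists_posDef_forall_trace_lt Φ (V := V) ha hb0 hg (by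
    intro T hT
    have hT1 := (hT.1.mem_dualBall_iff ha).mp hT
    have h := hV (matPow Tᵀ g⁻¹) (hT.1.transpose.matPow _) (by
      rwa [← powTrace, powTrace_transpose hT.1.1])
    rwa [hT.1.transpose.matPow_matPow, inv_mul_cancel₀ hg0.ne', hT.1.transpose.matPow_one] at h)
  change S.PosDef at hS
  refine ⟨matPow S g⁻¹, hS.matPow _, (hS.posSemidef.mem_dualBall_iff ha).mp hS1, ?_⟩
  rw [hS.posSemidef.matPow_matPow, mul_neg, inv_mul_cancel₀ hg0.ne', hS.matPow_neg_one]
  obtain ⟨T, hT, hT1, hTS⟩ := (PosSemidef.legMap Φ hS.posSemidef.inv).exists_trace_mul_eq ha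
  rw [← hTS]
  exact (h T ((hT.mem_dualBall_iff ha).mpr hT1)).le

end Legs

lemma _root_.Real.sSup_eq_neg_sSup {X Y : Set ℝ} (h : ∀ x ∈ X, ∀ y ∈ Y, x + y ≤ 0)
    (h' : ∀ ε > 0, ∃ x ∈ X, ∃ y ∈ Y, -ε ≤ x + y) : sSup X = -sSup Y := by
  obtain ⟨x₀, hx₀, y₀, hy₀, -⟩ := h' 1 one_pos
  have hX : BddAbove X := ⟨-y₀, fun x hx ↦ by linarith [h x hx y₀ hy₀]⟩
  have hY : BddAbove Y := ⟨-x₀, fun y hy ↦ by linarith [h x₀ hx₀ y hy]⟩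
  apply le_antisymm
  · refine csSup_le ⟨x₀, hx₀⟩ fun x hx ↦ ?_
    have : sSup Y ≤ -x := csSup_le ⟨y₀, hy₀⟩ fun y hy ↦ by linarith [h x hx y hy]
    linarith
  · refine le_of_forall_pos_le_add fun ε hε ↦ ?_
    obtain ⟨x, hx, y, hy, hxy⟩ := h' ε hε
    linarith [le_csSup hX hx, le_csSup hY hy]

lemma exists_posDef_trace_re_le_one (n : Type*) [Fintype n] [DecidableEq n] :
    ∃ σ : Matrix n n ℂ, σ.PosDef ∧ σ.trace.re ≤ 1 := by
  rcases isEmpty_or_nonempty n with h | h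
  · exact ⟨1, PosDef.one, by simp⟩
  · have hpos : (0 : ℝ) < (Fintype.card n : ℝ)⁻¹ :=
      inv_pos.mpr (Nat.cast_pos.mpr Fintype.card_pos)
    refine ⟨(Fintype.card n : ℝ)⁻¹ • 1, PosDef.one.smul hpos, ?_⟩
    simp

section Legs

variable {A B C : Type*} [Fintype A] [DecidableEq A] [Fintype B] [DecidableEq B]
  [Fintype C] [DecidableEq C]

omit [DecidableEq C] in
lemma trace_legMap_one (Φ : Matrix (A × B) C ℂ) : (legMap Φ 1).trace = (Φ * Φᴴ).trace := by
  rw [legMap, one_kronecker_one, Matrix.mul_one, trace_mul_comm]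

lemma trace_swapLegs (Φ : Matrix (A × B) C ℂ) :
    (swapLegs Φ * (swapLegs Φ)ᴴ).trace = (Φ * Φᴴ).trace := by
  have := trace_legMap_mul Φ 1 1
  rw [transpose_one, transpose_one, Matrix.mul_one, Matrix.mul_one, trace_legMap_one,
    trace_legMap_one] at this
  exact this.symm

omit [Fintype C] [DecidableEq C] in
lemma PosDef.dominates_one_kronecker {σ : Matrix B B ℂ} (hσ : σ.PosDef)
    (ρ : Matrix (A × B) (A × B) ℂ) : dominates ((1 : Matrix A A ℂ) ⊗ₖ σ) ρ := by
  intro v hv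
  have h := congrArg (((1 : Matrix A A ℂ) ⊗ₖ σ⁻¹) *ᵥ ·) hv
  rw [mulVec_mulVec, ← mul_kronecker_mul, one_mul,
    nonsing_inv_mul σ (σ.isUnit_iff_isUnit_det.mp hσ.isUnit), one_kronecker_one, one_mulVec,
    mulVec_zero] at h
  rw [h, mulVec_zero]

lemma powTrace_legMap_pos {Φ : Matrix (A × B) C ℂ} (hΦ : (Φ * Φᴴ).trace = 1)
    {σ : Matrix B B ℂ} (hσ : σ.PosDef) (s t : ℝ) : 0 < powTrace t (legMap Φ (matPow σ s)) := by
  rw [← trace_mul_one_kronecker_ne_zero_iff hσ.posSemidef s t,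
    trace_mul_one_kronecker_ne_zero_iff hσ.posSemidef 0 1, hσ.matPow_zero,
    (PosSemidef.legMap Φ PosSemidef.one).powTrace_one, trace_legMap_one, hΦ, Complex.one_re]
  exact one_pos

lemma condH_mul_conjTranspose (Φ : Matrix (A × B) C ℂ) (hΦ : (Φ * Φᴴ).trace = 1) {α : ℝ}
    (hα : 0 < α) :
    condH α (Φ * Φᴴ) = sSup {x : ℝ | ∃ σ : Matrix B B ℂ, σ.PosSemidef ∧ σ.trace.re ≤ 1 ∧
      0 < powTrace α (legMap Φ (matPow σ ((1 - α) / α))) ∧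
      (dominates ((1 : Matrix A A ℂ) ⊗ₖ σ) (Φ * Φᴴ) ∨ α < 1) ∧
      x = α / (1 - α) * Real.logb 2
        (powTrace α (legMap Φ (matPow σ ((1 - α) / α))) ^ (1 / α))} := by
  rw [condH]
  congr 1
  ext x
  refine exists_congr fun σ ↦ and_congr_right fun hσ ↦ ?_
  rw [coe_eq_neg_Dtilde_iff Φ hΦ hσ hα.ne',
    trace_mul_one_kronecker_ne_zero_iff hσ ((1 - α) / α) α]
  have hval (hP : 0 < powTrace α (legMap Φ (matPow σ ((1 - α) / α)))) :
      -((α - 1)⁻¹ * Real.logb 2 (powTrace α (legMap Φ (matPow σ ((1 - α) / α))))) =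
      α / (1 - α) * Real.logb 2
        (powTrace α (legMap Φ (matPow σ ((1 - α) / α))) ^ (1 / α)) := by
    rw [Real.logb_rpow_eq_mul_logb_of_pos hP, ← neg_sub 1 α, inv_neg, div_eq_mul_inv]
    field_simp
  constructor
  · rintro ⟨-, h1, ⟨h2, h3⟩, rfl⟩
    exact ⟨h1, h2, h3, hval h2⟩
  · rintro ⟨h1, h2, h3, rfl⟩
    refine ⟨?_, h1, ⟨h2, h3⟩, (hval h2).symm⟩
    rintro rfl
    rw [← trace_mul_one_kronecker_ne_zero_iff hσ] at h2
    simp at h2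

/-- The duality relation for the conditional entropies of a pure state, if the first order is
larger than one. -/
theorem condH_duality_of_one_lt (Φ : Matrix (A × B) C ℂ) (hΦ : (Φ * Φᴴ).trace = 1) {α β : ℝ}
    (hα : 1 < α) (hβ0 : 0 < β) (hαβ : 1 / α + 1 / β = 2) :
    condH α (Φ * Φᴴ) = -condH β (swapLegs Φ * (swapLegs Φ)ᴴ) := by
  have hΨ : (swapLegs Φ * (swapLegs Φ)ᴴ).trace = 1 := (trace_swapLegs Φ).trans hΦ
  have hα0 : 0 < α := by linarith
  rw [condH_mul_conjTranspose Φ hΦ hα0, condH_mul_conjTranspose _ hΨ hβ0]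
  obtain ⟨g, hgdef⟩ : ∃ g, g = (α - 1) / α := ⟨_, rfl⟩
  have hg0 : 0 < g := hgdef ▸ div_pos (by linarith) hα0
  have h1α : 1 / α = 1 - g := by rw [hgdef]; field_simp; ring
  have h1β : 1 / β = 1 + g := by linarith
  have hg : β * g = 1 - β := by
    have : β * (1 / β) = β * (1 + g) := by rw [h1β]
    rw [mul_one_div_cancel hβ0.ne'] at this
    linarith
  have hβ1 : β < 1 := by nlinarith [mul_pos hβ0 hg0]
  have hconj : α.HolderConjugate g⁻¹ := by
    rw [Real.holderConjugate_iff]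
    exact ⟨hα, by rw [inv_inv, ← one_div, h1α]; ring⟩
  have e1 : (1 - α) / α = -g := by rw [hgdef, ← neg_div, neg_sub]
  have e2 : (1 - β) / β = g := by rw [← hg, mul_div_cancel_left₀ _ hβ0.ne']
  have e3 : α / (1 - α) = -g⁻¹ := by rw [← inv_div, e1, inv_neg]
  have e4 : β / (1 - β) = g⁻¹ := by rw [← inv_div, e2]
  rw [e1, e2, e3, e4]
  set P : Matrix B B ℂ → ℝ := fun σ ↦ powTrace α (legMap Φ (matPow σ (-g))) ^ (1 / α) with hP
  set Q : Matrix C C ℂ → ℝ := fun τ ↦ powTrace β (legMap (swapLegs Φ) (matPow τ g)) ^ (1 / β)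
    with hQ
  apply Real.sSup_eq_neg_sSup
  · rintro _ ⟨σ, hσ, hσ1, hσ2, hdom, rfl⟩ _ ⟨τ, hτ, hτ1, hτ2, -, rfl⟩
    have h := powTrace_swapLegs_le hσ (hdom.resolve_right hα.not_gt) hσ1 hτ hτ1 hconj hβ0 hβ1 hg
    have hlog := Real.logb_le_logb_of_le one_lt_two (Real.rpow_pos_of_pos hτ2 _) h
    linarith [mul_le_mul_of_nonneg_left hlog (inv_pos.mpr hg0).le]
  · intro ε hε
    obtain ⟨σ₀, hσ₀, hσ₀1⟩ := exists_posDef_trace_re_le_one B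
    obtain ⟨τ₀, hτ₀, hτ₀1⟩ := exists_posDef_trace_re_le_one C
    set s : Set ℝ := {q | ∃ τ : Matrix C C ℂ, τ.PosSemidef ∧ τ.trace.re ≤ 1 ∧ q = Q τ}
    have hbdd : BddAbove s := by
      refine ⟨P σ₀, ?_⟩
      rintro _ ⟨τ, hτ, hτ1, rfl⟩
      exact powTrace_swapLegs_le hσ₀.posSemidef (hσ₀.dominates_one_kronecker _) hσ₀1 hτ hτ1 hconj
        hβ0 hβ1 hg
    have hmem : Q τ₀ ∈ s := ⟨τ₀, hτ₀.posSemidef, hτ₀1, rfl⟩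
    have hM : 0 < sSup s :=
      (Real.rpow_pos_of_pos (powTrace_legMap_pos hΨ hτ₀ g β) _).trans_le (le_csSup hbdd hmem)
    set r : ℝ := 2 ^ (g * ε / 2) with hr
    have hr1 : 1 < r := Real.one_lt_rpow one_lt_two (by positivity)
    have hr0 : 0 < r := by linarith
    obtain ⟨σ, hσ, hσ1, hσV⟩ := exists_posDef_powTrace_le Φ (V := r * sSup s) hconj hβ0 hg
      fun τ hτ hτ1 ↦ (le_csSup hbdd ⟨τ, hτ, hτ1, rfl⟩).trans_lt (lt_mul_of_one_lt_left hM hr1)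
    obtain ⟨_, ⟨τ, hτ, hτ1, rfl⟩, hτM⟩ := exists_lt_of_lt_csSup ⟨_, hmem⟩
      (div_lt_self hM hr1)
    have hσ2 := powTrace_legMap_pos hΦ hσ (-g) α
    have hQ0 : 0 < Q τ := (div_pos hM hr0).trans hτM
    have hτ2 : 0 < powTrace β (legMap (swapLegs Φ) (matPow τ g)) := by
      refine ((PosSemidef.legMap _ (hτ.matPow g)).powTrace_nonneg β).lt_of_ne' fun h0 ↦ ?_
      rw [hQ] at hQ0
      dsimp only at hQ0
      rw [h0, Real.zero_rpow (one_div_ne_zero hβ0.ne')] at hQ0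
      exact hQ0.false
    refine ⟨_, ⟨σ, hσ.posSemidef, hσ1, hσ2, Or.inl (hσ.dominates_one_kronecker _), rfl⟩,
      _, ⟨τ, hτ, hτ1, hτ2, Or.inr hβ1, rfl⟩, ?_⟩
    change -ε ≤ -g⁻¹ * Real.logb 2 (P σ) + g⁻¹ * Real.logb 2 (Q τ)
    have hPQ : P σ ≤ r * r * Q τ := by
      refine hσV.trans ?_
      rw [mul_assoc]
      rw [div_lt_iff₀ hr0, mul_comm] at hτM
      exact mul_le_mul_of_nonneg_left hτM.le hr0.le
    have hlog := Real.logb_le_logb_of_le one_lt_two (Real.rpow_pos_of_pos hσ2 _) hPQ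
    rw [Real.logb_mul (by positivity) hQ0.ne', Real.logb_mul hr0.ne' hr0.ne', hr,
      Real.logb_rpow two_pos (by norm_num)] at hlog
    have hlog' := mul_le_mul_of_nonneg_left hlog (inv_pos.mpr hg0).le
    have : g⁻¹ * (g * ε / 2 + g * ε / 2 + Real.logb 2 (Q τ)) = ε + g⁻¹ * Real.logb 2 (Q τ) := by
      field_simp
      ring
    change g⁻¹ * Real.logb 2 (P σ) ≤ _ at hlog'
    linarith

end Legs

end Matrix

/-- duality relation `H̃_α(A|B) = -H̃_β(A|C)` for a pure tripartite
state and `1/α + 1/β = 2`. -/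
theorem stmt15 {dA dB dC : ℕ} {α β : ℝ}
    (hα : α ∈ Set.Ioo (1 / 2 : ℝ) 1 ∪ Set.Ioi 1)
    (hβ : β ∈ Set.Ioo (1 / 2 : ℝ) 1 ∪ Set.Ioi 1)
    (hαβ : 1 / α + 1 / β = 2)
    (φ : Fin dA × Fin dB × Fin dC → ℂ)
    (hφ : ∑ i, Complex.normSq (φ i) = 1) :
    condH α (Matrix.of fun x y : Fin dA × Fin dB =>
        ∑ c : Fin dC, Matrix.vecMulVec φ (star φ) (x.1, x.2, c) (y.1, y.2, c))
      = - condH β (Matrix.of fun x y : Fin dA × Fin dC =>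
        ∑ b : Fin dB, Matrix.vecMulVec φ (star φ) (x.1, b, x.2) (y.1, b, y.2)) := by
  set Φ : Matrix (Fin dA × Fin dB) (Fin dC) ℂ := Matrix.of fun x c ↦ φ (x.1, x.2, c)
  have hAB : (Matrix.of fun x y : Fin dA × Fin dB =>
      ∑ c : Fin dC, Matrix.vecMulVec φ (star φ) (x.1, x.2, c) (y.1, y.2, c)) = Φ * Φᴴ := by
    ext x y
    simp [Φ, Matrix.mul_apply, Matrix.vecMulVec_apply]
  have hAC : (Matrix.of fun x y : Fin dA × Fin dC =>
      ∑ b : Fin dB, Matrix.vecMulVec φ (star φ) (x.1, b, x.2) (y.1, b, y.2)) =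
      Matrix.swapLegs Φ * (Matrix.swapLegs Φ)ᴴ := by
    ext x y
    simp [Φ, Matrix.swapLegs, Matrix.mul_apply, Matrix.vecMulVec_apply]
  have hΦ : (Φ * Φᴴ).trace = 1 := by
    have h : (Φ * Φᴴ).trace = ((∑ i, Complex.normSq (φ i) : ℝ) : ℂ) := by
      simp [Φ, Matrix.trace, Matrix.mul_apply, Complex.mul_conj, Fintype.sum_prod_type]
    rw [h, hφ, Complex.ofReal_one]
  have hpos : ∀ x ∈ Set.Ioo (1 / 2 : ℝ) 1 ∪ Set.Ioi 1, 0 < x := by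
    rintro x (⟨h, -⟩ | h)
    · linarith
    · exact one_pos.trans h
  have hα0 := hpos α hα
  have hβ0 := hpos β hβ
  rw [hAB, hAC]
  rcases hα with ⟨-, hα1⟩ | hα1
  · have h1 : 1 < 1 / α := (one_lt_div hα0).mpr hα1
    have hβ1 : 1 < β := (div_lt_one hβ0).mp (by linarith)
    have h := Matrix.condH_duality_of_one_lt (Matrix.swapLegs Φ)
      ((Matrix.trace_swapLegs Φ).trans hΦ) hβ1 hα0 (by linarith)
    rw [Matrix.swapLegs_swapLegs] at h
    rw [h, neg_neg]
  · exact Matrix.condH_duality_of_one_lt Φ hΦ hα1 hβ0 hαβ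
end

section
/- Let β ∈ [0, 1]. The map F(L, R) = L^β ⊗ (R^T)^(1−β), defined on pairs of positive semidefinite complex n×n matrices (with ⊗ the Kronecker product and R^T the transpose), is jointly operator concave: for all λ ∈ [0,1] and positive semidefinite L₁, L₂, R₁, R₂, the matrix (λL₁ + (1−λ)L₂)^β ⊗ ((λR₁ + (1−λ)R₂)^T)^(1−β) − λ·L₁^β ⊗ (R₁^T)^(1−β) − (1−λ)·L₂^β ⊗ (R₂^T)^(1−β) is positive semidefinite. -/
open Matrix
open scoped Kronecker Classical ComplexOrder

section Auxiliary

lemma isClosed_setOf_posSemidef {m : Type*} [Fintype m] :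
    IsClosed {A : Matrix m m ℂ | A.PosSemidef} := by
  simp only [posSemidef_iff_dotProduct_mulVec, Set.ofPred_and, Set.ofPred_forall]
  refine (isClosed_eq (by fun_prop) continuous_id).inter (isClosed_iInter fun x => ?_)
  exact isClosed_Ici.preimage (f := fun A : Matrix m m ℂ => star x ⬝ᵥ (A *ᵥ x)) (by fun_prop)

lemma Matrix.PosSemidef.convexComb {m : Type*} {l : ℝ} (hl : l ∈ Set.Icc (0 : ℝ) 1)
    {A B : Matrix m m ℂ} (hA : A.PosSemidef) (hB : B.PosSemidef) :
    ((l : ℂ) • A + ((1 - l : ℝ) : ℂ) • B).PosSemidef :=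
  (hA.smul (by exact_mod_cast hl.1)).add (hB.smul (by exact_mod_cast sub_nonneg.2 hl.2))

lemma Matrix.PosSemidef.fromBlocks_zero {m k : Type*} [Fintype m] [Fintype k]
    {A : Matrix m m ℂ} {B : Matrix k k ℂ} (hA : A.PosSemidef) (hB : B.PosSemidef) :
    (fromBlocks A 0 0 B).PosSemidef := by
  rw [posSemidef_iff_dotProduct_mulVec]
  refine ⟨.fromBlocks hA.1 (by simp) hB.1, fun x => ?_⟩
  rw [← Sum.elim_comp_inl_inr x, fromBlocks_mulVec, Function.star_sumElim,
    sumElim_dotProduct_sumElim]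
  simpa using add_nonneg (hA.dotProduct_mulVec_nonneg (x ∘ Sum.inl))
    (hB.dotProduct_mulVec_nonneg (x ∘ Sum.inr))

variable {m k : Type*} [Fintype m] [DecidableEq m] [Fintype k] [DecidableEq k]

/-- If the Lyapunov expression `C * Z + Z * C` with `C` positive definite is positive
semidefinite, then so is the Hermitian matrix `Z`. -/
lemma posSemidef_of_lyapunov {C Z : Matrix m m ℂ} (hC : C.PosDef) (hZ : Z.IsHermitian)
    (h : (C * Z + Z * C).PosSemidef) : Z.PosSemidef := by
  rw [hZ.posSemidef_iff_eigenvalues_nonneg]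
  intro i
  set v : m → ℂ := ⇑(hZ.eigenvectorBasis i)
  have hv0 : v ≠ 0 := by
    intro h0
    exact hZ.eigenvectorBasis.orthonormal.ne_zero i (by ext j; exact congrFun h0 j)
  have hZv : Z *ᵥ v = (hZ.eigenvalues i : ℂ) • v := by
    simpa using hZ.mulVec_eigenvectorBasis i
  have hvZ : star v ᵥ* Z = (hZ.eigenvalues i : ℂ) • star v := by
    have := congrArg star hZv
    rw [star_mulVec, hZ.eq] at this
    simpa using this
  have h1 := h.dotProduct_mulVec_nonneg v
  have h2 := hC.dotProduct_mulVec_pos hv0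
  have h3 : star v ⬝ᵥ ((C * Z + Z * C) *ᵥ v)
      = ((2 * hZ.eigenvalues i : ℝ) : ℂ) * (star v ⬝ᵥ (C *ᵥ v)) := by
    rw [add_mulVec, dotProduct_add, ← mulVec_mulVec, ← mulVec_mulVec, hZv,
      dotProduct_mulVec (star v) Z, hvZ, mulVec_smul, dotProduct_smul, smul_dotProduct]
    simp only [smul_eq_mul]
    push_cast
    ring
  rw [h3] at h1
  have h4 := (Complex.nonneg_iff.1 h1).1
  rw [Complex.re_ofReal_mul] at h4
  have h5 := nonneg_of_mul_nonneg_left h4 (Complex.pos_iff.1 h2).1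
  change 0 ≤ hZ.eigenvalues i
  linarith

lemma posSemidef_mul_sub_of_fromBlocks {P C X : Matrix m m ℂ} (hC : C.PosDef)
    (hPC : P * C = C * P)
    (h : (fromBlocks P X X (C * P * C)).PosSemidef) : (C * P - X).PosSemidef := by
  have hherm := isHermitian_fromBlocks_iff.mp h.isHermitian
  have hX : Xᴴ = X := hherm.2.1
  have hP : Pᴴ = P := hherm.1
  have hCh : Cᴴ = C := hC.isHermitian
  refine posSemidef_of_lyapunov hC ?_ ?_
  · rw [IsHermitian, conjTranspose_sub, conjTranspose_mul, hX, hP, hCh, hPC]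
  · have := h.conjTranspose_mul_mul_same (fromRows C (-1))
    rw [conjTranspose_fromRows_eq_fromCols_conjTranspose, fromCols_mul_fromBlocks,
      fromCols_mul_fromRows, hCh] at this
    convert this using 1
    simp only [conjTranspose_neg, conjTranspose_one, Matrix.mul_neg, Matrix.mul_one,
      Matrix.neg_mul, Matrix.one_mul, Matrix.add_mul, Matrix.mul_sub, Matrix.sub_mul,
      Matrix.mul_assoc, hPC]
    abel

/-- The matrix `W diag(f) Wᴴ`. -/
noncomputable def conjDiagonal (W : Matrix m m ℂ) (f : m → ℝ) : Matrix m m ℂ :=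
  W * diagonal (fun i => (f i : ℂ)) * Wᴴ

lemma conjDiagonal_mul {W : Matrix m m ℂ} (hW : Wᴴ * W = 1) (f g : m → ℝ) :
    conjDiagonal W f * conjDiagonal W g = conjDiagonal W (fun i => f i * g i) := by
  calc conjDiagonal W f * conjDiagonal W g
      = W * diagonal (fun i => (f i : ℂ)) * (Wᴴ * W) * diagonal (fun i => (g i : ℂ)) * Wᴴ := by
        simp only [conjDiagonal, Matrix.mul_assoc]
    _ = _ := by
        rw [hW, Matrix.mul_one, Matrix.mul_assoc W, diagonal_mul_diagonal]
        simp [conjDiagonal]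

lemma conjTranspose_conjDiagonal (W : Matrix m m ℂ) (f : m → ℝ) :
    (conjDiagonal W f)ᴴ = conjDiagonal W f := by
  have : star (fun i => (f i : ℂ)) = fun i => (f i : ℂ) := by
    ext i; simp
  simp [conjDiagonal, diagonal_conjTranspose, Matrix.mul_assoc, this]

lemma posDef_conjDiagonal {W : Matrix m m ℂ} (hW : Wᴴ * W = 1) {f : m → ℝ} (hf : ∀ i, 0 < f i) :
    (conjDiagonal W f).PosDef := by
  have hd : (diagonal (fun i => (f i : ℂ))).PosDef :=
    PosDef.diagonal fun i => by exact_mod_cast hf i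
  refine hd.mul_mul_conjTranspose_same ?_
  intro x y hxy
  have := congrArg (fun z => z ᵥ* Wᴴ) hxy
  simpa [vecMul_vecMul, mul_eq_one_comm.mp hW] using this

lemma continuous_conjDiagonal {T : Type*} [TopologicalSpace T] (W : Matrix m m ℂ) {f : T → m → ℝ}
    (hf : Continuous f) : Continuous fun t => conjDiagonal W (f t) := by
  unfold conjDiagonal
  fun_prop

lemma conjDiagonal_kronecker (U : Matrix m m ℂ) (V : Matrix k k ℂ) (f : m → ℝ) (g : k → ℝ) :
    conjDiagonal U f ⊗ₖ conjDiagonal V g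
      = conjDiagonal (U ⊗ₖ V) (fun i => f i.1 * g i.2) := by
  simp only [conjDiagonal, mul_kronecker_mul, diagonal_kronecker_diagonal, conjTranspose_kronecker]
  simp

lemma posSemidef_fromBlocks_conjDiagonal {W : Matrix m m ℂ} (hW : Wᴴ * W = 1) (p q : m → ℝ) :
    (fromBlocks (conjDiagonal W (fun i => p i * p i)) (conjDiagonal W (fun i => p i * q i))
      (conjDiagonal W (fun i => p i * q i)) (conjDiagonal W (fun i => q i * q i))).PosSemidef := by
  convert posSemidef_self_mul_conjTranspose (fromRows (conjDiagonal W p) (conjDiagonal W q)) using 1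
  rw [conjTranspose_fromRows_eq_fromCols_conjTranspose, fromRows_mul_fromCols]
  simp only [conjTranspose_conjDiagonal, conjDiagonal_mul hW, mul_comm]

/-- The geometric mean of two commuting positive semidefinite matrices is an upper bound of all
off-diagonal blocks `X` making `[[P, X], [X, Q]]` positive semidefinite. -/
lemma posSemidef_conjDiagonal_sqrt_sub {W X : Matrix m m ℂ} (hW : Wᴴ * W = 1) {p q : m → ℝ}
    (hp : ∀ i, 0 ≤ p i) (hq : ∀ i, 0 ≤ q i)
    (h : (fromBlocks (conjDiagonal W p) X X (conjDiagonal W q)).PosSemidef) :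
    (conjDiagonal W (fun i => √(p i) * √(q i)) - X).PosSemidef := by
  have key : ∀ ε : ℝ, 0 < ε →
      (conjDiagonal W (fun i => √(p i + ε) * √(q i + ε)) - X).PosSemidef := by
    intro ε hε
    have hp' : ∀ i, 0 < p i + ε := fun i => by linarith [hp i]
    have hq' : ∀ i, 0 < q i + ε := fun i => by linarith [hq i]
    have hC := posDef_conjDiagonal hW (f := fun i => √(q i + ε) / √(p i + ε))
      fun i => div_pos (Real.sqrt_pos.2 (hq' i)) (Real.sqrt_pos.2 (hp' i))
    have hadd : ∀ f : m → ℝ,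
        conjDiagonal W (fun i => f i + ε) = conjDiagonal W f + (ε : ℂ) • 1 := by
      intro f
      have : (diagonal fun i => ((f i + ε : ℝ) : ℂ)) = diagonal (fun i => (f i : ℂ)) +
          (ε : ℂ) • (1 : Matrix m m ℂ) := by
        ext i j
        by_cases hij : i = j <;> simp [hij]
      rw [conjDiagonal, this, Matrix.mul_add, Matrix.add_mul, mul_smul_comm, smul_mul_assoc,
        Matrix.mul_one, mul_eq_one_comm.mp hW, conjDiagonal]
    have hblock : (fromBlocks (conjDiagonal W (fun i => p i + ε)) X X
        (conjDiagonal W (fun i => q i + ε))).PosSemidef := by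
      have hε1 : ((ε : ℂ) • (1 : Matrix (m ⊕ m) (m ⊕ m) ℂ)).PosSemidef :=
        PosSemidef.one.smul (by exact_mod_cast hε.le)
      convert h.add hε1 using 1
      rw [← fromBlocks_one, fromBlocks_smul, fromBlocks_add, hadd, hadd]
      simp
    have := posSemidef_mul_sub_of_fromBlocks (P := conjDiagonal W (fun i => p i + ε)) (X := X) hC
      (by simp only [conjDiagonal_mul hW, mul_comm])
      (by
        convert hblock using 2
        rw [conjDiagonal_mul hW, conjDiagonal_mul hW]
        congr 1
        ext i
        have := (Real.sqrt_pos.2 (hp' i)).ne'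
        field_simp
        rw [Real.sq_sqrt (hp' i).le, Real.sq_sqrt (hq' i).le])
    convert this using 2
    rw [conjDiagonal_mul hW]
    congr 1
    ext i
    have h0 := (Real.sqrt_pos.2 (hp' i)).ne'
    field_simp
    rw [Real.sq_sqrt (hp' i).le]
  have hlim : Filter.Tendsto
      (fun ε : ℝ => conjDiagonal W (fun i => √(p i + ε) * √(q i + ε)) - X)
      (nhdsWithin 0 (Set.Ioi 0)) (nhds (conjDiagonal W (fun i => √(p i) * √(q i)) - X)) := by
    have hc : Continuous fun ε : ℝ => conjDiagonal W (fun i => √(p i + ε) * √(q i + ε)) - X :=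
      (continuous_conjDiagonal W (by fun_prop)).sub continuous_const
    have := hc.tendsto 0
    simp only [add_zero] at this
    exact this.mono_left nhdsWithin_le_nhds
  exact isClosed_setOf_posSemidef.mem_of_tendsto hlim
    (Filter.eventually_of_mem self_mem_nhdsWithin key)

lemma Matrix.IsHermitian.cfc_eq_conjDiagonal {A : Matrix m m ℂ} (hA : A.IsHermitian) (f : ℝ → ℝ) :
    cfc f A =
      conjDiagonal (hA.eigenvectorUnitary : Matrix m m ℂ) (fun i => f (hA.eigenvalues i)) := by
  rw [hA.cfc_eq, IsHermitian.cfc, Unitary.conjStarAlgAut_apply]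
  rfl

/-- The map `(L, S) ↦ L^t ⊗ S^(1-t)`, with the convention `0 ^ 0 = 1`. -/
noncomputable def kroneckerRpow (t : ℝ) (L : Matrix m m ℂ) (S : Matrix k k ℂ) :
    Matrix (m × k) (m × k) ℂ :=
  cfc (fun x : ℝ => x ^ t) L ⊗ₖ cfc (fun x : ℝ => x ^ (1 - t)) S

lemma exists_kroneckerRpow_eq_conjDiagonal {L : Matrix m m ℂ} {S : Matrix k k ℂ}
    (hL : L.PosSemidef) (hS : S.PosSemidef) :
    ∃ (W : Matrix (m × k) (m × k) ℂ) (a b : m × k → ℝ), Wᴴ * W = 1 ∧ (∀ i, 0 ≤ a i) ∧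
      (∀ i, 0 ≤ b i) ∧
      ∀ t, kroneckerRpow t L S = conjDiagonal W (fun i => a i ^ t * b i ^ (1 - t)) := by
  refine ⟨(hL.1.eigenvectorUnitary : Matrix m m ℂ) ⊗ₖ (hS.1.eigenvectorUnitary : Matrix k k ℂ),
    fun i => hL.1.eigenvalues i.1, fun i => hS.1.eigenvalues i.2, ?_,
    fun i => hL.eigenvalues_nonneg _, fun i => hS.eigenvalues_nonneg _, fun t => ?_⟩
  · rw [conjTranspose_kronecker, ← mul_kronecker_mul, ← star_eq_conjTranspose,
      ← star_eq_conjTranspose, Unitary.coe_star_mul_self, Unitary.coe_star_mul_self,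
      one_kronecker_one]
  · rw [kroneckerRpow, hL.1.cfc_eq_conjDiagonal, hS.1.cfc_eq_conjDiagonal, conjDiagonal_kronecker]

lemma sqrt_mul_sqrt_rpow_mul_rpow {a b s t r : ℝ} (ha : 0 ≤ a) (hb : 0 ≤ b)
    (hs : s ∈ Set.Icc (0 : ℝ) 1) (ht : t ∈ Set.Icc (0 : ℝ) 1) (hr : s + t = r + r) :
    √(a ^ s * b ^ (1 - s)) * √(a ^ t * b ^ (1 - t)) = a ^ r * b ^ (1 - r) := by
  obtain ⟨hs0, hs1⟩ := hs
  obtain ⟨ht0, ht1⟩ := ht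
  rw [← Real.sqrt_mul (by positivity), Real.sqrt_eq_iff_mul_self_eq (by positivity) (by positivity),
    eq_comm]
  calc a ^ r * b ^ (1 - r) * (a ^ r * b ^ (1 - r))
      = (a ^ r * a ^ r) * (b ^ (1 - r) * b ^ (1 - r)) := by ring
    _ = (a ^ s * a ^ t) * (b ^ (1 - s) * b ^ (1 - t)) := by
        rw [← Real.rpow_add_of_nonneg ha (by linarith) (by linarith),
          ← Real.rpow_add_of_nonneg hb (by linarith) (by linarith),
          ← Real.rpow_add_of_nonneg ha (by linarith) (by linarith),
          ← Real.rpow_add_of_nonneg hb (by linarith) (by linarith), hr]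
        congr 2
        linarith
    _ = _ := by ring

/-- Midpoint (Ando) block matrix attached to a pair of positive semidefinite matrices. -/
lemma posSemidef_fromBlocks_kroneckerRpow {L : Matrix m m ℂ} {S : Matrix k k ℂ}
    (hL : L.PosSemidef) (hS : S.PosSemidef) {s t r : ℝ}
    (hs : s ∈ Set.Icc (0 : ℝ) 1) (ht : t ∈ Set.Icc (0 : ℝ) 1) (hr : s + t = r + r) :
    (fromBlocks (kroneckerRpow s L S) (kroneckerRpow r L S)
      (kroneckerRpow r L S) (kroneckerRpow t L S)).PosSemidef := by
  obtain ⟨W, a, b, hW, ha, hb, h⟩ := exists_kroneckerRpow_eq_conjDiagonal hL hS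
  have := posSemidef_fromBlocks_conjDiagonal hW (fun i => √(a i ^ s * b i ^ (1 - s)))
    (fun i => √(a i ^ t * b i ^ (1 - t)))
  have hn : ∀ (u : ℝ) i, 0 ≤ a i ^ u * b i ^ (1 - u) := fun u i =>
    mul_nonneg (Real.rpow_nonneg (ha i) _) (Real.rpow_nonneg (hb i) _)
  simp only [sqrt_mul_sqrt_rpow_mul_rpow (ha _) (hb _) hs ht hr, Real.mul_self_sqrt (hn _ _)]
    at this
  simpa only [h] using this

/-- Joint operator concavity of a map on pairs of positive semidefinite matrices. -/
def JointlyConcave (F : Matrix m m ℂ → Matrix k k ℂ → Matrix (m × k) (m × k) ℂ) : Prop :=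
  ∀ ⦃l : ℝ⦄, l ∈ Set.Icc (0 : ℝ) 1 → ∀ ⦃L₁ L₂ : Matrix m m ℂ⦄ ⦃S₁ S₂ : Matrix k k ℂ⦄,
    L₁.PosSemidef → L₂.PosSemidef → S₁.PosSemidef → S₂.PosSemidef →
    (F ((l : ℂ) • L₁ + ((1 - l : ℝ) : ℂ) • L₂) ((l : ℂ) • S₁ + ((1 - l : ℝ) : ℂ) • S₂)
      - ((l : ℂ) • F L₁ S₁ + ((1 - l : ℝ) : ℂ) • F L₂ S₂)).PosSemidef

lemma JointlyConcave.midpoint {s t r : ℝ}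
    (hs : s ∈ Set.Icc (0 : ℝ) 1) (ht : t ∈ Set.Icc (0 : ℝ) 1) (hr : s + t = r + r)
    (hFs : JointlyConcave (kroneckerRpow (m := m) (k := k) s))
    (hFt : JointlyConcave (kroneckerRpow (m := m) (k := k) t)) :
    JointlyConcave (kroneckerRpow (m := m) (k := k) r) := by
  intro l hl L₁ L₂ S₁ S₂ hL₁ hL₂ hS₁ hS₂
  obtain ⟨W, a, b, hW, ha, hb, h⟩ := exists_kroneckerRpow_eq_conjDiagonal
    (hL₁.convexComb hl hL₂) (hS₁.convexComb hl hS₂)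
  have hn : ∀ (u : ℝ) i, 0 ≤ a i ^ u * b i ^ (1 - u) := fun u i =>
    mul_nonneg (Real.rpow_nonneg (ha i) _) (Real.rpow_nonneg (hb i) _)
  have hcomb := (posSemidef_fromBlocks_kroneckerRpow hL₁ hS₁ hs ht hr).convexComb hl
    (posSemidef_fromBlocks_kroneckerRpow hL₂ hS₂ hs ht hr)
  have hdiag := (hFs hl hL₁ hL₂ hS₁ hS₂).fromBlocks_zero (hFt hl hL₁ hL₂ hS₁ hS₂)
  have hblock := hcomb.add hdiag
  rw [fromBlocks_smul, fromBlocks_smul, fromBlocks_add, fromBlocks_add, add_sub_cancel,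
    add_sub_cancel, add_zero, h s, h t] at hblock
  have := posSemidef_conjDiagonal_sqrt_sub hW (hn s) (hn t) hblock
  simp only [sqrt_mul_sqrt_rpow_mul_rpow (ha _) (hb _) hs ht hr] at this
  rwa [h r]

lemma kroneckerRpow_zero {L : Matrix m m ℂ} {S : Matrix k k ℂ} (hL : L.PosSemidef)
    (hS : S.PosSemidef) : kroneckerRpow 0 L S = 1 ⊗ₖ S := by
  simp only [kroneckerRpow, Real.rpow_zero, sub_zero, Real.rpow_one]
  rw [cfc_const_one ℝ L hL.1.isSelfAdjoint, cfc_id' ℝ S hS.1.isSelfAdjoint]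

lemma kroneckerRpow_one {L : Matrix m m ℂ} {S : Matrix k k ℂ} (hL : L.PosSemidef)
    (hS : S.PosSemidef) : kroneckerRpow 1 L S = L ⊗ₖ 1 := by
  simp only [kroneckerRpow, Real.rpow_zero, sub_self, Real.rpow_one]
  rw [cfc_const_one ℝ S hS.1.isSelfAdjoint, cfc_id' ℝ L hL.1.isSelfAdjoint]

lemma jointlyConcave_kroneckerRpow_zero :
    JointlyConcave (kroneckerRpow (m := m) (k := k) 0) := by
  intro l hl L₁ L₂ S₁ S₂ hL₁ hL₂ hS₁ hS₂
  rw [kroneckerRpow_zero hL₁ hS₁, kroneckerRpow_zero hL₂ hS₂,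
    kroneckerRpow_zero (hL₁.convexComb hl hL₂) (hS₁.convexComb hl hS₂), kronecker_add,
    kronecker_smul, kronecker_smul, sub_self]
  exact .zero

lemma jointlyConcave_kroneckerRpow_one :
    JointlyConcave (kroneckerRpow (m := m) (k := k) 1) := by
  intro l hl L₁ L₂ S₁ S₂ hL₁ hL₂ hS₁ hS₂
  rw [kroneckerRpow_one hL₁ hS₁, kroneckerRpow_one hL₂ hS₂,
    kroneckerRpow_one (hL₁.convexComb hl hL₂) (hS₁.convexComb hl hS₂), add_kronecker,
    smul_kronecker, smul_kronecker, sub_self]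
  exact .zero

lemma jointlyConcave_kroneckerRpow_dyadic (N j : ℕ) (hj : j ≤ 2 ^ N) :
    JointlyConcave (kroneckerRpow (m := m) (k := k) ((j : ℝ) / 2 ^ N)) := by
  induction N generalizing j with
  | zero =>
    obtain rfl | rfl : j = 0 ∨ j = 1 := by simp at hj; omega
    · simpa using jointlyConcave_kroneckerRpow_zero
    · simpa using jointlyConcave_kroneckerRpow_one
  | succ N ih =>
    have hmem : ∀ i : ℕ, i ≤ 2 ^ N → (i : ℝ) / 2 ^ N ∈ Set.Icc (0 : ℝ) 1 := fun i hi =>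
      ⟨by positivity, (div_le_one (by positivity)).2 (by exact_mod_cast hi)⟩
    rw [pow_succ] at hj
    have h1 : j / 2 ≤ 2 ^ N := by omega
    have h2 : (j + 1) / 2 ≤ 2 ^ N := by omega
    refine JointlyConcave.midpoint (hmem _ h1) (hmem _ h2) ?_ (ih _ h1) (ih _ h2)
    have h3 : ((j / 2 : ℕ) : ℝ) + ((j + 1) / 2 : ℕ) = j := by
      exact_mod_cast (by omega : j / 2 + (j + 1) / 2 = j)
    rw [← add_div, h3, pow_succ]
    field_simp
    norm_num

lemma matPow_eq_conjDiagonal {A : Matrix m m ℂ} (hA : A.IsHermitian) (t : ℝ) :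
    matPow A t = conjDiagonal (hA.eigenvectorUnitary : Matrix m m ℂ)
      (fun i => if hA.eigenvalues i = 0 then 0 else hA.eigenvalues i ^ t) := by
  rw [matPow, dif_pos hA]
  rfl

lemma matPow_eq_cfc {A : Matrix m m ℂ} (hA : A.IsHermitian) {t : ℝ} (ht : t ≠ 0) :
    matPow A t = cfc (fun x : ℝ => x ^ t) A := by
  rw [matPow_eq_conjDiagonal hA, hA.cfc_eq_conjDiagonal]
  congr 1
  ext i
  split_ifs with h
  · rw [h, Real.zero_rpow ht]
  · rfl

lemma continuous_matPow (A : Matrix m m ℂ) : Continuous fun t => matPow A t := by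
  by_cases hA : A.IsHermitian
  · simp only [matPow_eq_conjDiagonal hA]
    refine continuous_conjDiagonal _ (continuous_pi fun i => ?_)
    split_ifs with h
    · exact continuous_const
    · exact Real.continuous_const_rpow h
  · simp only [matPow, dif_neg hA]
    exact continuous_const

lemma continuous_matPow_kronecker_matPow (L : Matrix m m ℂ) (S : Matrix k k ℂ) :
    Continuous fun t => matPow L t ⊗ₖ matPow S (1 - t) := by
  have h1 := continuous_matPow L
  have h2 := (continuous_matPow S).comp (continuous_const (y := (1 : ℝ)) |>.sub continuous_id)
  refine continuous_matrix fun i j => ?_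
  exact (h1.matrix_elem i.1 j.1).mul (h2.matrix_elem i.2 j.2)

lemma isClosed_setOf_jointlyConcave_matPow :
    IsClosed {t : ℝ | JointlyConcave
      fun (L : Matrix m m ℂ) (S : Matrix k k ℂ) => matPow L t ⊗ₖ matPow S (1 - t)} := by
  simp only [JointlyConcave, Set.ofPred_forall]
  refine isClosed_iInter fun l => isClosed_iInter fun _ => isClosed_iInter fun L₁ =>
    isClosed_iInter fun L₂ => isClosed_iInter fun S₁ => isClosed_iInter fun S₂ =>
    isClosed_iInter fun _ => isClosed_iInter fun _ => isClosed_iInter fun _ =>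
    isClosed_iInter fun _ => isClosed_setOf_posSemidef.preimage ?_
  exact (continuous_matPow_kronecker_matPow _ _).sub
    (((continuous_matPow_kronecker_matPow L₁ S₁).const_smul (l : ℂ)).add
      ((continuous_matPow_kronecker_matPow L₂ S₂).const_smul ((1 - l : ℝ) : ℂ)))

lemma jointlyConcave_matPow_dyadic {N j : ℕ} (h0 : 0 < (j : ℝ) / 2 ^ N)
    (h1 : (j : ℝ) / 2 ^ N < 1) :
    JointlyConcave fun (L : Matrix m m ℂ) (S : Matrix k k ℂ) =>
      matPow L ((j : ℝ) / 2 ^ N) ⊗ₖ matPow S (1 - (j : ℝ) / 2 ^ N) := by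
  have hj : j ≤ 2 ^ N := by
    rw [div_lt_one (by positivity)] at h1
    exact_mod_cast h1.le
  intro l hl L₁ L₂ S₁ S₂ hL₁ hL₂ hS₁ hS₂
  have h := jointlyConcave_kroneckerRpow_dyadic N j hj hl hL₁ hL₂ hS₁ hS₂
  have h1' : 1 - (j : ℝ) / 2 ^ N ≠ 0 := (sub_pos.2 h1).ne'
  simpa only [kroneckerRpow, matPow_eq_cfc hL₁.1 h0.ne', matPow_eq_cfc hL₂.1 h0.ne',
    matPow_eq_cfc hS₁.1 h1', matPow_eq_cfc hS₂.1 h1',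
    matPow_eq_cfc (hL₁.convexComb hl hL₂).1 h0.ne',
    matPow_eq_cfc (hS₁.convexComb hl hS₂).1 h1'] using h

/-- Lieb's concavity theorem in Ando's tensor product form. -/
theorem jointlyConcave_matPow {β : ℝ} (hβ : β ∈ Set.Icc (0 : ℝ) 1) :
    JointlyConcave fun (L : Matrix m m ℂ) (S : Matrix k k ℂ) =>
      matPow L β ⊗ₖ matPow S (1 - β) := by
  have hIoo : Set.Ioo (0 : ℝ) 1 ⊆ {t : ℝ | JointlyConcave
      fun (L : Matrix m m ℂ) (S : Matrix k k ℂ) => matPow L t ⊗ₖ matPow S (1 - t)} := by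
    intro t ht
    have hpow : Filter.Tendsto (fun N : ℕ => (2 : ℝ) ^ N) Filter.atTop Filter.atTop :=
      tendsto_pow_atTop_atTop_of_one_lt one_lt_two
    have hlim := (tendsto_nat_floor_mul_div_atTop ht.1.le).comp hpow
    refine isClosed_setOf_jointlyConcave_matPow.mem_of_tendsto hlim ?_
    filter_upwards [hlim.eventually (Ioo_mem_nhds ht.1 ht.2)] with N hN
    exact jointlyConcave_matPow_dyadic hN.1 hN.2
  have hIcc := isClosed_setOf_jointlyConcave_matPow.closure_subset_iff.2 hIoo
  rw [closure_Ioo zero_ne_one] at hIcc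
  exact hIcc hβ

end Auxiliary

/-- joint operator concavity of `(L, R) ↦ L^β ⊗ (R^T)^(1-β)` on pairs
of positive semidefinite matrices, for `β ∈ [0, 1]`. -/
theorem stmt17 {n : ℕ} {β : ℝ} (hβ : β ∈ Set.Icc (0 : ℝ) 1)
    {l : ℝ} (hl : l ∈ Set.Icc (0 : ℝ) 1)
    {L₁ L₂ R₁ R₂ : Matrix (Fin n) (Fin n) ℂ}
    (hL₁ : L₁.PosSemidef) (hL₂ : L₂.PosSemidef)
    (hR₁ : R₁.PosSemidef) (hR₂ : R₂.PosSemidef) :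
    (matPow ((l : ℂ) • L₁ + ((1 - l : ℝ) : ℂ) • L₂) β ⊗ₖ
        matPow (((l : ℂ) • R₁ + ((1 - l : ℝ) : ℂ) • R₂)ᵀ) (1 - β)
      - ((l : ℂ) • (matPow L₁ β ⊗ₖ matPow R₁ᵀ (1 - β))
          + ((1 - l : ℝ) : ℂ) • (matPow L₂ β ⊗ₖ matPow R₂ᵀ (1 - β)))).PosSemidef := by
  rw [transpose_add, transpose_smul, transpose_smul]
  exact jointlyConcave_matPow hβ hl hL₁ hL₂ hR₁.transpose hR₂.transpose
end
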